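/- arXiv:2511.10584 — 3 statements merged into one kernel-verified Lean document; each statement's English description precedes it below -/
import Mathlib

section
/- Let S be an n×k complex matrix with S†S = I_k, let α ∈ [1/2, 1), and let Ψ_{α,S}(G, Z) := Tr[(G^{1/2} S† Z^{(1−α)/α} S G^{1/2})^α], regarded as a smooth function on the open set of pairs (G,Z) of positive definite Hermitian matrices inside the real vector space ℍ^k × ℍ^n. Then Ψ_{α,S} is (ℝ_≥, 1)-compatible with the closed cone ℍ^k_⪰ × ℍ^n_⪰: for every positive definite pair (G,Z) and every direction (H,K) ∈ ℍ^k × ℍ^n such that G+H, G−H, Z+K, Z−K are all positive semidefinite, the directional derivatives satisfy D³Ψ_{α,S}(G,Z)[(H,K),(H,K),(H,K)] ≤ −3·D²Ψ_{α,S}(G,Z)[(H,K),(H,K)]. -/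
open Matrix
open scoped ComplexOrder

/-- The real power of a matrix, taken via the continuous functional calculus applied to
`x ↦ x ^ p` (real `rpow`). -/
noncomputable def mpow {n : ℕ} (A : Matrix (Fin n) (Fin n) ℂ) (p : ℝ) :
    Matrix (Fin n) (Fin n) ℂ :=
  cfc (fun x : ℝ => x ^ p) A

/-- `Ψ_{α,S}(G, Z) := Tr[(G^{1/2} Sᴴ Z^{(1−α)/α} S G^{1/2})^α]` (real-valued). -/
noncomputable def PsiS {n k : ℕ} (α : ℝ) (S : Matrix (Fin n) (Fin k) ℂ)
    (G : Matrix (Fin k) (Fin k) ℂ) (Z : Matrix (Fin n) (Fin n) ℂ) : ℝ :=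
  ((mpow (mpow G (1 / 2) * Sᴴ * mpow Z ((1 - α) / α) * S * mpow G (1 / 2)) α).trace).re

theorem re_taylorCoeff_combination_nonneg {q R : ℂ → ℂ} {c₀ c₁ c₂ c₃ : ℂ}
    (hR : DifferentiableOn ℂ R (Metric.ball 0 1))
    (hq : ∀ w, q w = c₀ + c₁ * w + c₂ * w ^ 2 + c₃ * w ^ 3 + w ^ 4 * R w)
    (him : ∀ w ∈ Metric.ball (0 : ℂ) 1, 0 ≤ (q w).im * w.im) :
    0 ≤ (5 * c₁ + 4 * c₂ + c₃).re := by
  have key : ∀ r : ℝ, r ∈ Set.Ioo (0 : ℝ) 1 → 0 ≤ (5 * r * c₁ + 4 * r ^ 2 * c₂ + r ^ 3 * c₃).re := by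
    rintro r ⟨hr0, hr1⟩
    have hrC : (r : ℂ) ≠ 0 := by exact_mod_cast hr0.ne'
    have hqd : DifferentiableOn ℂ q (Metric.ball 0 1) := by
      rw [show q = _ from funext hq]; fun_prop
    set P : ℂ → ℂ := fun w => q w * (w ^ 2 / r ^ 3 + 4 * w / r ^ 2 + 5 / r)
      + R w * (-5 * r * w ^ 2 - 4 * r ^ 2 * w - r ^ 3) + (-5 * r * c₂ - 4 * r ^ 2 * c₃)
      - 5 * r * c₃ * w with hP
    have hsub : Metric.closedBall (0 : ℂ) r ⊆ Metric.ball 0 1 := Metric.closedBall_subset_ball hr1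
    have hPd : DifferentiableOn ℂ P (Metric.ball 0 1) := by
      simp only [hP]; fun_prop
    have hP0 : (∮ w in C(0, r), P w) = 0 := by
      refine DiffContOnCl.circleIntegral_eq_zero hr0.le ?_
      apply DifferentiableOn.diffContOnCl
      rw [closure_ball _ hr0.ne']
      exact hPd.mono hsub
    have hPi : CircleIntegrable P 0 r :=
      (hPd.continuousOn.mono (Metric.sphere_subset_closedBall.trans hsub)).circleIntegrable hr0.le
    have hzi : ∀ n : ℤ, CircleIntegrable (fun w : ℂ => (w - 0) ^ n) 0 r := fun n => by
      rw [circleIntegrable_sub_zpow_iff]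
      right; right; simp [abs_of_pos hr0, hr0.ne]
    set S : ℂ := 5 * r * c₁ + 4 * r ^ 2 * c₂ + r ^ 3 * c₃ with hS
    set Q : ℂ → ℂ := fun w => q w *
      ((w / r) ^ 3 + 4 * (w / r) ^ 2 + 5 * (w / r) - 5 * (r / w) - 4 * (r / w) ^ 2 - (r / w) ^ 3)
      * w⁻¹ with hQ
    have h1 : (∮ w in C(0, r), Q w) = - (2 * Real.pi * Complex.I * S) := by
      have : (∮ w in C(0, r), Q w) = ∮ w in C(0, r), (P w + ((-S) * (w - 0) ^ (-1 : ℤ)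
          + ((-5 * r * c₀ - 4 * r ^ 2 * c₁ - r ^ 3 * c₂) * (w - 0) ^ (-2 : ℤ)
          + ((-4 * r ^ 2 * c₀ - r ^ 3 * c₁) * (w - 0) ^ (-3 : ℤ)
          + (-r ^ 3 * c₀) * (w - 0) ^ (-4 : ℤ))))) := by
        refine circleIntegral.integral_congr hr0.le fun w hw => ?_
        have hw0 : w ≠ 0 := by
          rintro rfl; simp [hr0.ne] at hw
        simp only [hQ, hP, hS, hq w, sub_zero, _root_.zpow_neg, zpow_ofNat]
        field_simp
        ring
      rw [this]
      have i1 := fun (a : ℂ) (n : ℤ) => (hzi n).const_smul (a := a)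
      simp only [Pi.smul_def, smul_eq_mul] at i1
      rw [circleIntegral.integral_add hPi (by exact (i1 _ _).add ((i1 _ _).add ((i1 _ _).add (i1 _ _)))),
        circleIntegral.integral_add (i1 _ _) (by exact ((i1 _ _).add ((i1 _ _).add (i1 _ _)))),
        circleIntegral.integral_add (i1 _ _) (by exact ((i1 _ _).add (i1 _ _))),
        circleIntegral.integral_add (i1 _ _) (i1 _ _)]
      simp only [circleIntegral.integral_const_mul, hP0]
      rw [circleIntegral.integral_sub_zpow_of_ne (n := -2) (by decide),
        circleIntegral.integral_sub_zpow_of_ne (n := -3) (by decide),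
        circleIntegral.integral_sub_zpow_of_ne (n := -4) (by decide)]
      simp only [_root_.zpow_neg_one, circleIntegral.integral_sub_center_inv _ hr0.ne']
      ring
    set κ : ℝ → ℝ := fun θ => 4 * Real.sin θ * (1 + Real.cos θ) ^ 2 with hκ
    have h2 : (∮ w in C(0, r), Q w) = -2 * ∫ θ in (0 : ℝ)..2 * Real.pi, q (circleMap 0 r θ) * κ θ := by
      rw [circleIntegral, ← intervalIntegral.integral_const_mul]
      refine intervalIntegral.integral_congr fun θ _ => ?_
      have e0 : Complex.exp (θ * Complex.I) ≠ 0 := Complex.exp_ne_zero _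
      have e1 : circleMap 0 r θ = r * Complex.exp (θ * Complex.I) := by simp [circleMap]
      simp only [hQ, hκ, smul_eq_mul, deriv_circleMap, e1]
      generalize q (r * Complex.exp (θ * Complex.I)) = Z
      have hs : ((Real.sin θ : ℝ) : ℂ) = (Complex.exp (θ * Complex.I) - (Complex.exp (θ * Complex.I))⁻¹) / (2 * Complex.I) := by
        rw [← Complex.exp_neg]
        push_cast
        rw [Complex.sin, div_eq_div_iff (by norm_num) (by simp)]
        ring_nf; simp [Complex.I_sq]
      have hc : ((Real.cos θ : ℝ) : ℂ) = (Complex.exp (θ * Complex.I) + (Complex.exp (θ * Complex.I))⁻¹) / 2 := by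
        rw [← Complex.exp_neg]
        push_cast
        rw [Complex.cos]; ring_nf
      push_cast [hs, hc]
      generalize Complex.exp (θ * Complex.I) = x at e0
      have hI := Complex.I_ne_zero
      field_simp
      ring_nf
      simp only [Complex.I_sq]
      ring
    have hcont : Continuous fun θ : ℝ => q (circleMap 0 r θ) * κ θ := by
      refine Continuous.mul ?_ (by simp only [hκ]; fun_prop)
      refine hqd.continuousOn.comp_continuous (continuous_circleMap _ _) fun θ => ?_
      exact hsub (circleMap_mem_closedBall _ hr0.le _)
    have h3 : 0 ≤ (∫ θ in (0 : ℝ)..2 * Real.pi, q (circleMap 0 r θ) * κ θ).im := by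
      have : (∫ θ in (0 : ℝ)..2 * Real.pi, q (circleMap 0 r θ) * κ θ).im
          = ∫ θ in (0 : ℝ)..2 * Real.pi, (q (circleMap 0 r θ) * κ θ).im := by
        have := Complex.imCLM.intervalIntegral_comp_comm (hcont.intervalIntegrable (μ := MeasureTheory.volume) 0 (2 * Real.pi))
        simpa using this.symm
      rw [this]
      refine intervalIntegral.integral_nonneg (by positivity) fun θ _ => ?_
      have hm := him _ (hsub (circleMap_mem_closedBall 0 hr0.le θ))
      have him' : (circleMap 0 r θ).im = r * Real.sin θ := by
        simp [circleMap, Complex.exp_ofReal_mul_I_im]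
      rw [him'] at hm
      have : (q (circleMap 0 r θ) * κ θ).im =
          ((q (circleMap 0 r θ)).im * (r * Real.sin θ)) * (4 * (1 + Real.cos θ) ^ 2 / r) := by
        rw [Complex.im_mul_ofReal]; simp only [hκ]; field_simp
      rw [this]
      positivity
    have h4 := congrArg Complex.im (h1.symm.trans h2)
    have e5 : (-(2 * Real.pi * Complex.I * S)).im = -(2 * Real.pi * S.re) := by
      simp
    have e6 : ∀ z : ℂ, (-2 * z).im = -2 * z.im := fun z => by simp
    rw [e5, e6] at h4
    have := Real.pi_pos
    by_contra hneg
    push Not at hneg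
    nlinarith
  have hlim : Filter.Tendsto (fun r : ℝ => (5 * r * c₁ + 4 * r ^ 2 * c₂ + r ^ 3 * c₃ : ℂ).re)
      (nhdsWithin 1 (Set.Iio 1)) (nhds (5 * c₁ + 4 * c₂ + c₃).re) := by
    have : Continuous fun r : ℝ => (5 * r * c₁ + 4 * r ^ 2 * c₂ + r ^ 3 * c₃ : ℂ).re := by fun_prop
    convert (this.tendsto 1).mono_left nhdsWithin_le_nhds using 2
    simp
  refine ge_of_tendsto hlim ?_
  filter_upwards [Ioo_mem_nhdsLT (show (0 : ℝ) < 1 by norm_num)] with r hr using key r hr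

theorem cubic_coeffs_eq_zero_of_tendsto {p₀ p₁ p₂ p₃ : ℝ}
    (h : Filter.Tendsto (fun w : ℝ => (p₀ + p₁ * w + p₂ * w ^ 2 + p₃ * w ^ 3) / w ^ 3)
      (nhdsWithin 0 {0}ᶜ) (nhds 0)) : p₀ = 0 ∧ p₁ = 0 ∧ p₂ = 0 ∧ p₃ = 0 := by
  have hid : ∀ n : ℕ, Filter.Tendsto (fun w : ℝ => w ^ (n + 1)) (nhdsWithin 0 {0}ᶜ) (nhds 0) :=
    fun n => by
      have : Continuous fun w : ℝ => w ^ (n + 1) := by fun_prop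
      simpa using (this.tendsto 0).mono_left nhdsWithin_le_nhds
  have aux : ∀ {g k : ℝ → ℝ}, Continuous g →
      Filter.Tendsto k (nhdsWithin 0 {0}ᶜ) (nhds 0) → (∀ w ≠ 0, k w = g w) → g 0 = 0 := by
    intro g k hg hk hkg
    refine tendsto_nhds_unique ((hg.tendsto 0).mono_left nhdsWithin_le_nhds) (hk.congr' ?_)
    filter_upwards [self_mem_nhdsWithin] with w hw using hkg w hw
  have h0 : p₀ = 0 := by
    have := aux (g := fun w => p₀ + p₁ * w + p₂ * w ^ 2 + p₃ * w ^ 3) (by fun_prop)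
      (by simpa only [mul_zero] using h.mul (hid 2)) (fun w hw => by field_simp; ring)
    norm_num at this
    exact this
  subst h0
  have h1 : p₁ = 0 := by
    have := aux (g := fun w => p₁ + p₂ * w + p₃ * w ^ 2) (by fun_prop)
      (by simpa only [mul_zero] using h.mul (hid 1)) (fun w hw => by field_simp; ring)
    norm_num at this
    exact this
  subst h1
  have h2 : p₂ = 0 := by
    have := aux (g := fun w => p₂ + p₃ * w) (by fun_prop)
      (by simpa only [mul_zero] using h.mul (hid 0)) (fun w hw => by field_simp; ring)
    norm_num at this
    exact this
  subst h2
  have h3 : p₃ = 0 :=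
    aux (g := fun w => p₃) (by fun_prop) h (fun w hw => by field_simp; ring)
  exact ⟨rfl, rfl, rfl, h3⟩

theorem exists_taylor_remainder {q : ℂ → ℂ} (hq : DifferentiableOn ℂ q (Metric.ball 0 1)) :
    ∃ (c₀ c₁ c₂ c₃ : ℂ) (R : ℂ → ℂ), DifferentiableOn ℂ R (Metric.ball 0 1) ∧
      ∀ w, q w = c₀ + c₁ * w + c₂ * w ^ 2 + c₃ * w ^ 3 + w ^ 4 * R w := by
  have hn : Metric.ball (0 : ℂ) 1 ∈ nhds 0 := Metric.ball_mem_nhds _ one_pos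
  have step : ∀ f : ℂ → ℂ, ∀ w, f w = f 0 + w * dslope f 0 w := fun f w => by
    have := sub_smul_dslope f 0 w
    simp only [sub_zero, smul_eq_mul] at this
    rw [this]; ring
  set q₁ := dslope q 0
  set q₂ := dslope q₁ 0
  set q₃ := dslope q₂ 0
  refine ⟨q 0, q₁ 0, q₂ 0, q₃ 0, dslope q₃ 0, ?_, fun w => ?_⟩
  · simpa only [Complex.differentiableOn_dslope hn, q₁, q₂, q₃] using hq
  · linear_combination step q w + w * step q₁ w + w ^ 2 * step q₂ w + w ^ 3 * step q₃ w

theorem exists_cubic_expansion {f : ℝ → ℝ} (hf : ContDiffOn ℝ 3 f (Set.Ioo (-1) 1)) :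
    (fun t => f t - (f 0 + deriv f 0 * t + iteratedDeriv 2 f 0 / 2 * t ^ 2
      + iteratedDeriv 3 f 0 / 6 * t ^ 3)) =o[nhds 0] fun t => t ^ 3 := by
  have h0 : (0 : ℝ) ∈ Set.Ioo (-1 : ℝ) 1 := by norm_num
  have h := taylor_isLittleO (convex_Ioo (-1 : ℝ) 1) h0 (n := 3) (by exact_mod_cast hf)
  rw [isOpen_Ioo.nhdsWithin_eq h0] at h
  simp only [sub_zero] at h
  refine h.congr (fun t => ?_) fun _ => rfl
  simp only [taylorWithinEval_succ, taylor_within_zero_eval,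
    iteratedDerivWithin_of_isOpen isOpen_Ioo h0]
  simp [iteratedDeriv_one, Nat.factorial]
  ring

theorem third_deriv_le_of_halfplane {f : ℝ → ℝ} {h : ℂ → ℂ}
    (hd : DifferentiableOn ℂ h {s | 0 < s.re})
    (hsec : ∀ s : ℂ, 0 < s.re → |(h s).im| * s.re ≤ (h s).re * |s.im|)
    (hf : ∀ s : ℝ, 0 < s → f ((s ^ 2 - 1) / (s ^ 2 + 1)) = 2 * s / (s ^ 2 + 1) * (h s).re) :
    iteratedDeriv 3 f 0 ≤ -3 * iteratedDeriv 2 f 0 := by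
  have hopen : IsOpen {s : ℂ | 0 < s.re} := isOpen_lt continuous_const Complex.continuous_re
  have hsm : ContDiffOn ℝ 3 f (Set.Ioo (-1) 1) := by
    have hcd : ContDiffOn ℝ 3 (fun s : ℝ => (h s).re) (Set.Ioi 0) := by
      have h1 : ContDiffOn ℝ 3 h {s | 0 < s.re} := (hd.contDiffOn hopen).restrict_scalars ℝ
      exact Complex.reCLM.contDiff.comp_contDiffOn
        (h1.comp Complex.ofRealCLM.contDiff.contDiffOn fun s hs => by simpa using hs)
    have hs : ContDiffOn ℝ 3 (fun t : ℝ => √((1 + t) / (1 - t))) (Set.Ioo (-1) 1) := by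
      intro t ht
      have h1 : 1 - t ≠ 0 := by linarith [ht.2]
      have h2 : (1 + t) / (1 - t) ≠ 0 := (div_pos (by linarith [ht.1]) (by linarith [ht.2])).ne'
      exact ((ContDiffAt.div (by fun_prop) (by fun_prop) h1).sqrt h2).contDiffWithinAt
    have hpos : ∀ t ∈ Set.Ioo (-1 : ℝ) 1, 0 < (1 + t) / (1 - t) := fun t ht =>
      div_pos (by linarith [ht.1]) (by linarith [ht.2])
    refine ContDiffOn.congr (f := fun t : ℝ => 2 * √((1 + t) / (1 - t)) /
      (√((1 + t) / (1 - t)) ^ 2 + 1) * (h (√((1 + t) / (1 - t)) : ℝ)).re) ?_ ?_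
    · refine ContDiffOn.mul (ContDiffOn.div (contDiffOn_const.mul hs) ((hs.pow 2).add contDiffOn_const) fun t _ => by positivity) ?_
      exact hcd.comp hs fun t ht => Real.sqrt_pos.2 (hpos t ht)
    · intro t ht
      have h1 : 1 - t ≠ 0 := by linarith [ht.2]
      rw [← hf _ (Real.sqrt_pos.2 (hpos t ht)), Real.sq_sqrt (hpos t ht).le]
      congr 1
      field_simp
      ring
  set σ : ℂ → ℂ := fun w => (1 + w) / (1 - w) with hσ
  have hne : ∀ w ∈ Metric.ball (0 : ℂ) 1, 1 - w ≠ 0 ∧ 1 + w ≠ 0 := by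
    intro w hw
    rw [mem_ball_zero_iff] at hw
    constructor
    · intro h0
      rw [← sub_eq_zero.1 h0] at hw; simp at hw
    · intro h0
      rw [← neg_eq_of_add_eq_zero_right h0] at hw; simp at hw
  have hσre : ∀ w ∈ Metric.ball (0 : ℂ) 1, 0 < (σ w).re := by
    intro w hw
    have h1 := (hne w hw).1
    rw [mem_ball_zero_iff, ← sq_lt_one_iff₀ (norm_nonneg _), ← Complex.normSq_eq_norm_sq,
      Complex.normSq_apply] at hw
    simp only [hσ, Complex.div_re, ← add_div]
    refine div_pos ?_ (Complex.normSq_pos.2 h1)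
    simp; nlinarith
  have hσim : ∀ w : ℂ, (σ w).im = 2 * w.im / Complex.normSq (1 - w) := by
    intro w
    simp only [hσ, Complex.div_im, ← sub_div]
    congr 1
    simp; ring
  set q : ℂ → ℂ := fun w => -(σ w)⁻¹ * h (σ w) with hq
  have hqd : DifferentiableOn ℂ q (Metric.ball 0 1) := by
    have hσd : DifferentiableOn ℂ σ (Metric.ball 0 1) := by
      refine DifferentiableOn.div (by fun_prop) (by fun_prop) fun w hw => (hne w hw).1
    refine DifferentiableOn.mul (DifferentiableOn.neg (DifferentiableOn.inv hσd ?_)) (hd.comp hσd hσre)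
    intro w hw h0
    have := hσre w hw
    rw [h0] at this; simp at this
  obtain ⟨c₀, c₁, c₂, c₃, R, hR, hqe⟩ := exists_taylor_remainder hqd
  have hpos := re_taylorCoeff_combination_nonneg hR hqe (by
    intro w hw
    have h1 := hsec _ (hσre w hw)
    have h2 := hσre w hw
    have h3 : 0 < Complex.normSq (1 - w) := Complex.normSq_pos.2 (hne w hw).1
    have h4 : w.im = (σ w).im * (Complex.normSq (1 - w) / 2) := by
      rw [hσim]; field_simp
    rw [h4, ← mul_assoc]
    refine mul_nonneg ?_ (by positivity)
    have h5 : (q w).im = ((σ w).im * (h (σ w)).re - (σ w).re * (h (σ w)).im) / Complex.normSq (σ w) := by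
      simp [hq, Complex.inv_re, Complex.inv_im]; ring
    rw [h5, div_mul_eq_mul_div]
    refine div_nonneg ?_ (Complex.normSq_nonneg _)
    generalize σ w = s at *
    generalize h s = z at *
    have h6 : |z.im| * s.re * |s.im| ≤ z.re * |s.im| * |s.im| :=
      mul_le_mul_of_nonneg_right h1 (abs_nonneg _)
    have h7 : z.im * s.im ≤ |z.im| * |s.im| := by rw [← abs_mul]; exact le_abs_self _
    have h8 : |s.im| * |s.im| = s.im * s.im := abs_mul_abs_self _
    have h9 := mul_le_mul_of_nonneg_right h7 h2.le
    rw [mul_assoc z.re, h8] at h6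
    nlinarith)
  have hexp := exists_cubic_expansion hsm
  set f₁ := deriv f 0
  set f₂ := iteratedDeriv 2 f 0
  set f₃ := iteratedDeriv 3 f 0
  set τ : ℝ → ℝ := fun w => 2 * w / (1 + w ^ 2) with hτ
  have hτ0 : Filter.Tendsto τ (nhds 0) (nhds 0) := by
    have : Continuous τ := by
      simp only [hτ]
      exact Continuous.div (by fun_prop) (by fun_prop) fun w => by positivity
    simpa [hτ] using this.tendsto 0
  have hrem : (fun w => f (τ w) - (f 0 + f₁ * τ w + f₂ / 2 * τ w ^ 2 + f₃ / 6 * τ w ^ 3))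
      =o[nhds 0] fun w : ℝ => w ^ 3 := by
    refine (hexp.comp_tendsto hτ0).trans_isBigO ?_
    refine Asymptotics.IsBigO.of_bound 8 (Filter.Eventually.of_forall fun w => ?_)
    simp only [Function.comp, hτ, norm_pow, norm_div, norm_mul, Real.norm_ofNat]
    have : 1 ≤ ‖1 + w ^ 2‖ := by
      rw [Real.norm_of_nonneg (by positivity)]; nlinarith [sq_nonneg w]
    have h1 : 2 * ‖w‖ / ‖1 + w ^ 2‖ ≤ 2 * ‖w‖ := div_le_self (by positivity) this
    calc _ ≤ (2 * ‖w‖) ^ 3 := by gcongr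
      _ = _ := by ring
  have hrel : ∀ w : ℝ, w ∈ Set.Ioo (-1 : ℝ) 1 →
      (1 + w) ^ 2 * (q w).re = -(1 + w ^ 2) * f (τ w) := by
    intro w hw
    have h1 : (1 - w) ≠ 0 := by linarith [hw.2]
    have h1' : (1 + w) ≠ 0 := by linarith [hw.1]
    have h2 : 0 < (1 + w) / (1 - w) := div_pos (by linarith [hw.1]) (by linarith [hw.2])
    have h3 := hf _ h2
    have h4 : (((1 + w) / (1 - w)) ^ 2 - 1) / (((1 + w) / (1 - w)) ^ 2 + 1) = τ w := by
      have : (1 + w) ^ 2 + (1 - w) ^ 2 ≠ 0 := by positivity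
      simp only [hτ]
      field_simp
      ring
    have h5 : σ w = (((1 + w) / (1 - w) : ℝ) : ℂ) := by simp [hσ]
    rw [h4] at h3
    have h6 : (q w).re = - (((1 + w) / (1 - w))⁻¹ * (h (((1 + w) / (1 - w) : ℝ) : ℂ)).re) := by
      simp only [hq, h5, ← Complex.ofReal_inv, ← Complex.ofReal_neg, Complex.re_ofReal_mul]; ring
    rw [h3, h6]
    generalize (h (((1 + w) / (1 - w) : ℝ) : ℂ)).re = z
    have : (1 + w) ^ 2 + (1 - w) ^ 2 ≠ 0 := by positivity
    field_simp
    ring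
  set L := nhdsWithin (0 : ℝ) {0}ᶜ
  have hLn : L ≤ nhds 0 := nhdsWithin_le_nhds
  have hlim1 : Filter.Tendsto (fun w : ℝ => (f (τ w) - (f 0 + f₁ * τ w + f₂ / 2 * τ w ^ 2
      + f₃ / 6 * τ w ^ 3)) / w ^ 3) L (nhds 0) := (hrem.mono hLn).tendsto_div_nhds_zero
  have hRc : ContinuousAt (fun w : ℝ => (R w).re) 0 := by
    have : ContinuousAt R ((0 : ℝ) : ℂ) := by
      simpa using (hR.continuousOn.continuousAt (Metric.ball_mem_nhds _ one_pos))
    exact Complex.continuous_re.continuousAt.comp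
      (this.comp Complex.continuous_ofReal.continuousAt)
  have hqre : ∀ w : ℝ, (q w).re = c₀.re + c₁.re * w + c₂.re * w ^ 2 + c₃.re * w ^ 3 + w ^ 4 * (R w).re := by
    intro w
    rw [hqe w]
    simp only [← Complex.ofReal_pow, Complex.add_re, Complex.re_mul_ofReal, Complex.re_ofReal_mul]
  have hlim2 : Filter.Tendsto (fun w : ℝ =>
      ((c₀.re + f 0) + (c₁.re + 2 * c₀.re + 2 * f₁) * w
        + (c₂.re + 2 * c₁.re + c₀.re + f 0 + 2 * f₂) * w ^ 2
        + (c₃.re + 2 * c₂.re + c₁.re + 4 / 3 * f₃) * w ^ 3) / w ^ 3) L (nhds 0) := by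
    have hgoal : Filter.Tendsto (fun w : ℝ => -(1 + w ^ 2) * ((f (τ w) - (f 0 + f₁ * τ w
        + f₂ / 2 * τ w ^ 2 + f₃ / 6 * τ w ^ 3)) / w ^ 3)
        - w * ((1 + w) ^ 2 * (R w).re + c₂.re + 2 * c₃.re + w * c₃.re)
        + w * (2 * f₂ / (1 + w ^ 2)) + 4 / 3 * f₃ * w ^ 2 * (2 + w ^ 2) / (1 + w ^ 2) ^ 2) L (nhds 0) := by
      have a1 : Filter.Tendsto (fun w : ℝ => -(1 + w ^ 2)) L (nhds (-(1 + 0 ^ 2))) :=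
        (Continuous.tendsto (by fun_prop) _).mono_left hLn
      have a2 : ContinuousAt (fun w : ℝ => w * ((1 + w) ^ 2 * (R w).re + c₂.re + 2 * c₃.re + w * c₃.re)) 0 := by
        fun_prop
      have a3 : ContinuousAt (fun w : ℝ => w * (2 * f₂ / (1 + w ^ 2))) 0 := by
        refine ContinuousAt.mul (by fun_prop) (ContinuousAt.div (by fun_prop) (by fun_prop) (by norm_num))
      have a4 : ContinuousAt (fun w : ℝ => 4 / 3 * f₃ * w ^ 2 * (2 + w ^ 2) / (1 + w ^ 2) ^ 2) 0 := by
        refine ContinuousAt.div (by fun_prop) (by fun_prop) (by norm_num)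
      simpa using (((a1.mul hlim1).sub (a2.tendsto.mono_left hLn)).add (a3.tendsto.mono_left hLn)).add
        (a4.tendsto.mono_left hLn)
    refine hgoal.congr' ?_
    have hev : ∀ᶠ w in L, w ∈ Set.Ioo (-1 : ℝ) 1 := hLn (Ioo_mem_nhds (by norm_num) (by norm_num))
    filter_upwards [hev, self_mem_nhdsWithin] with w hw hw0
    have hw0 : w ≠ 0 := hw0
    have hr := hrel w hw
    rw [hqre] at hr
    have hp : (1 + w ^ 2) ≠ 0 := by positivity
    have hff : f (τ w) = -((1 + w) ^ 2 * (c₀.re + c₁.re * w + c₂.re * w ^ 2 + c₃.re * w ^ 3 + w ^ 4 * (R w).re)) / (1 + w ^ 2) := by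
      rw [hr]; field_simp
    rw [hff]
    simp only [hτ]
    field_simp
    ring
  obtain ⟨e0, e1, e2, e3⟩ := cubic_coeffs_eq_zero_of_tendsto hlim2
  simp only [Complex.add_re, Complex.mul_re, Complex.re_ofNat, Complex.im_ofNat, zero_mul,
    sub_zero] at hpos
  linarith

section Accretive

variable {m : Type*} [Fintype m]

/-- The quadratic form `v ↦ v† N v` of a square complex matrix. -/
def qform (N : Matrix m m ℂ) (v : m → ℂ) : ℂ := star v ⬝ᵥ N *ᵥ v

/-- A matrix is (strictly) accretive if its quadratic form has positive real part. -/
def Accretive (N : Matrix m m ℂ) : Prop := ∀ v ≠ 0, 0 < (qform N v).re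

theorem qform_eq_sum (N : Matrix m m ℂ) (v : m → ℂ) :
    qform N v = ∑ i, ∑ j, star (v i) * (N i j * v j) := by
  simp [qform, dotProduct, mulVec, Finset.mul_sum]

theorem qform_add (M N : Matrix m m ℂ) (v : m → ℂ) : qform (M + N) v = qform M v + qform N v := by
  simp [qform, add_mulVec]

theorem qform_smul (c : ℂ) (N : Matrix m m ℂ) (v : m → ℂ) : qform (c • N) v = c * qform N v := by
  simp [qform, smul_mulVec]

theorem qform_zero (N : Matrix m m ℂ) : qform N 0 = 0 := by
  simp [qform]

theorem qform_conjTranspose (N : Matrix m m ℂ) (v : m → ℂ) : qform Nᴴ v = star (qform N v) := by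
  rw [qform, qform, star_dotProduct, star_mulVec, conjTranspose_conjTranspose, dotProduct_mulVec]

theorem dotProduct_mulVec_conjTranspose {l : Type*} [Fintype l] (A : Matrix l m ℂ) (u : l → ℂ) (w : m → ℂ) :
    star (A *ᵥ w) ⬝ᵥ u = star w ⬝ᵥ Aᴴ *ᵥ u := by
  rw [star_mulVec, dotProduct_mulVec]

theorem qform_conj {l : Type*} [Fintype l] (A : Matrix l m ℂ) (N : Matrix l l ℂ) (v : m → ℂ) :
    qform (Aᴴ * N * A) v = qform N (A *ᵥ v) := by
  rw [qform, qform, dotProduct_mulVec_conjTranspose, mulVec_mulVec, mulVec_mulVec]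

theorem Matrix.PosDef.qform_pos {N : Matrix m m ℂ} (hN : N.PosDef) {v : m → ℂ} (hv : v ≠ 0) :
    0 < (qform N v).re ∧ (qform N v).im = 0 := by
  have := hN.dotProduct_mulVec_pos hv
  exact ⟨(Complex.pos_iff.1 this).1, (Complex.pos_iff.1 this).2.symm⟩

theorem Matrix.PosDef.accretive {N : Matrix m m ℂ} (hN : N.PosDef) : Accretive N :=
  fun _ hv => (hN.qform_pos hv).1

theorem Accretive.add {M N : Matrix m m ℂ} (hM : Accretive M) (hN : Accretive N) :
    Accretive (M + N) := fun v hv => by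
  rw [qform_add, Complex.add_re]; exact add_pos (hM v hv) (hN v hv)

theorem Accretive.smul {N : Matrix m m ℂ} (hN : Accretive N) {t : ℝ} (ht : 0 < t) :
    Accretive ((t : ℂ) • N) := fun v hv => by
  rw [qform_smul, Complex.re_ofReal_mul]; exact mul_pos ht (hN v hv)

theorem Accretive.isUnit_det [DecidableEq m] {N : Matrix m m ℂ} (hN : Accretive N) : IsUnit N.det := by
  rw [isUnit_iff_ne_zero]
  intro h
  obtain ⟨v, hv, h0⟩ := Matrix.exists_mulVec_eq_zero_iff.2 h
  have := hN v hv
  simp [qform, h0] at this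

theorem Accretive.mul_inv_cancel [DecidableEq m] {N : Matrix m m ℂ} (hN : Accretive N) : N * N⁻¹ = 1 :=
  Matrix.mul_nonsing_inv _ hN.isUnit_det

theorem Accretive.inv_mul_cancel [DecidableEq m] {N : Matrix m m ℂ} (hN : Accretive N) : N⁻¹ * N = 1 :=
  Matrix.nonsing_inv_mul _ hN.isUnit_det

theorem Accretive.qform_inv [DecidableEq m] {N : Matrix m m ℂ} (hN : Accretive N) (v : m → ℂ) :
    qform N⁻¹ v = star (qform N (N⁻¹ *ᵥ v)) := by
  have h : v = N *ᵥ (N⁻¹ *ᵥ v) := by rw [mulVec_mulVec, hN.mul_inv_cancel, one_mulVec]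
  rw [← qform_conjTranspose, qform, qform, ← dotProduct_mulVec_conjTranspose, ← h]

theorem Accretive.inv_mulVec_ne_zero [DecidableEq m] {N : Matrix m m ℂ} (hN : Accretive N) {v : m → ℂ}
    (hv : v ≠ 0) : N⁻¹ *ᵥ v ≠ 0 := by
  intro h
  apply hv
  have h' : v = N *ᵥ (N⁻¹ *ᵥ v) := by rw [mulVec_mulVec, hN.mul_inv_cancel, one_mulVec]
  rw [h', h, mulVec_zero]

theorem Accretive.inv [DecidableEq m] {N : Matrix m m ℂ} (hN : Accretive N) : Accretive N⁻¹ := fun v hv => by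
  rw [hN.qform_inv]
  simpa using hN _ (hN.inv_mulVec_ne_zero hv)

theorem norm_qform_le (N : Matrix m m ℂ) (v : m → ℂ) :
    ‖qform N v‖ ≤ (∑ i, ∑ j, ‖N i j‖) * ‖v‖ ^ 2 := by
  rw [qform, dotProduct, Finset.sum_mul]
  refine (norm_sum_le _ _).trans (Finset.sum_le_sum fun i _ => ?_)
  rw [norm_mul, mulVec, dotProduct, Finset.sum_mul]
  calc _ ≤ ‖v‖ * ∑ j, ‖N i j‖ * ‖v‖ := by
        refine mul_le_mul (by simpa using norm_le_pi_norm v i) ?_ (norm_nonneg _) (norm_nonneg _)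
        refine (norm_sum_le _ _).trans (Finset.sum_le_sum fun j _ => ?_)
        rw [norm_mul]
        exact mul_le_mul_of_nonneg_left (norm_le_pi_norm v j) (norm_nonneg _)
    _ = _ := by rw [Finset.mul_sum]; exact Finset.sum_congr rfl fun j _ => by ring

theorem qform_real_smul (N : Matrix m m ℂ) (r : ℝ) (v : m → ℂ) :
    qform N ((r : ℂ) • v) = (r ^ 2 : ℝ) * qform N v := by
  simp [qform, mulVec_smul, dotProduct_smul, smul_dotProduct]; ring

theorem Accretive.exists_lower_bound {N : Matrix m m ℂ} (hN : Accretive N) :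
    ∃ η > 0, ∀ v, η * ‖v‖ ^ 2 ≤ (qform N v).re := by
  have hc : Continuous fun v : m → ℂ => (qform N v).re := by
    unfold qform dotProduct
    simp only [mulVec, dotProduct]
    fun_prop
  have hnorm : ∀ v : m → ℂ, v ≠ 0 → ((‖v‖⁻¹ : ℝ) : ℂ) • v ∈ Metric.sphere (0 : m → ℂ) 1 := by
    intro v hv
    rw [mem_sphere_zero_iff_norm, norm_smul]
    simp [norm_ne_zero_iff.2 hv]
  by_cases hne : ∃ v : m → ℂ, v ≠ 0
  · obtain ⟨v₀, hv₀⟩ := hne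
    obtain ⟨u, hu, hmin⟩ := (isCompact_sphere (0 : m → ℂ) 1).exists_isMinOn
      ⟨_, hnorm v₀ hv₀⟩ hc.continuousOn
    have hu0 : u ≠ 0 := by
      rintro rfl; simp at hu
    refine ⟨_, hN u hu0, fun v => ?_⟩
    by_cases hv : v = 0
    · simp [hv, qform_zero]
    · have h1 := hmin (hnorm v hv)
      simp only [Set.mem_ofPred_eq, qform_real_smul, Complex.re_ofReal_mul] at h1
      have h2 : 0 < ‖v‖ := norm_pos_iff.2 hv
      calc _ ≤ ‖v‖⁻¹ ^ 2 * (qform N v).re * ‖v‖ ^ 2 := by gcongr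
        _ = _ := by field_simp
  · push Not at hne
    exact ⟨1, one_pos, fun v => by simp [hne v, qform_zero]⟩

theorem Accretive.eventually_lower_bound {X : Type*} [TopologicalSpace X] {E : X → Matrix m m ℂ}
    {x₀ : X} (hE : ∀ i j, ContinuousAt (fun x => E x i j) x₀) (h : Accretive (E x₀)) :
    ∃ η > 0, ∀ᶠ x in nhds x₀, ∀ v, η * ‖v‖ ^ 2 ≤ (qform (E x) v).re := by
  obtain ⟨η, hη, hb⟩ := h.exists_lower_bound
  have hs : ContinuousAt (fun x => ∑ i, ∑ j, ‖(E x - E x₀) i j‖) x₀ := by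
    simp only [Matrix.sub_apply]
    fun_prop
  have hev := hs.eventually_lt (continuousAt_const (y := η / 2)) (by simpa using hη)
  refine ⟨η / 2, by positivity, hev.mono fun x hx v => ?_⟩
  have h1 := (Complex.abs_re_le_norm _).trans (norm_qform_le (E x - E x₀) v)
  have h2 : qform (E x) v = qform (E x₀) v + qform (E x - E x₀) v := by
    rw [← qform_add, add_sub_cancel]
  have h3 := mul_le_mul_of_nonneg_right hx.le (sq_nonneg ‖v‖)
  rw [h2, Complex.add_re]
  linarith [hb v, neg_abs_le (qform (E x - E x₀) v).re]

theorem norm_inv_apply_le [DecidableEq m] {N : Matrix m m ℂ} {η : ℝ} (hη : 0 < η)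
    (h : ∀ v, η * ‖v‖ ^ 2 ≤ (qform N v).re) (i j : m) : ‖N⁻¹ i j‖ ≤ η⁻¹ := by
  have hN : Accretive N := fun v hv => lt_of_lt_of_le (by have := norm_pos_iff.2 hv; positivity) (h v)
  set x := N⁻¹ *ᵥ Pi.single j 1 with hx
  have hxi : N⁻¹ i j = x i := by simp [hx]
  have h1 := h x
  have h2 : N *ᵥ x = Pi.single j 1 := by
    rw [hx, mulVec_mulVec, hN.mul_inv_cancel, one_mulVec]
  have h3 : (qform N x).re ≤ ‖x‖ := by
    rw [qform, h2, dotProduct_single_one]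
    exact (Complex.re_le_norm _).trans (by simpa using norm_le_pi_norm x j)
  rw [hxi]
  refine (norm_le_pi_norm x i).trans ?_
  rcases (norm_nonneg x).eq_or_lt with h0 | h0
  · rw [← h0]; positivity
  · rw [le_inv_comm₀ h0 hη, inv_eq_one_div, le_div_iff₀ h0]
    nlinarith

end Accretive

theorem differentiableOn_setIntegral_Ioi {F : ℂ → ℝ → ℂ} {U : Set ℂ} (hU : IsOpen U)
    (hd : ∀ t ∈ Set.Ioi (0 : ℝ), DifferentiableOn ℂ (fun z => F z t) U)
    (hc : ∀ z ∈ U, ContinuousOn (F z) (Set.Ioi 0))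
    (hb : ∀ z₀ ∈ U, ∃ b : ℝ → ℝ, MeasureTheory.IntegrableOn b (Set.Ioi 0) ∧
      ∀ᶠ z in nhds z₀, ∀ t ∈ Set.Ioi (0 : ℝ), ‖F z t‖ ≤ b t) :
    DifferentiableOn ℂ (fun z => ∫ t in Set.Ioi (0 : ℝ), F z t) U := by
  intro z₀ hz₀
  obtain ⟨b, hbi, hbb⟩ := hb z₀ hz₀
  obtain ⟨ε, hε, hball⟩ := Metric.eventually_nhds_iff_ball.1 (hbb.and (hU.mem_nhds hz₀))
  have hmeas : ∀ z ∈ U, MeasureTheory.AEStronglyMeasurable (F z)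
      (MeasureTheory.volume.restrict (Set.Ioi (0 : ℝ))) := fun z hz =>
    (hc z hz).aestronglyMeasurable measurableSet_Ioi
  have hda : ∀ t ∈ Set.Ioi (0 : ℝ), ∀ z ∈ U, DifferentiableAt ℂ (fun z => F z t) z :=
    fun t ht z hz => (hd t ht z hz).differentiableAt (hU.mem_nhds hz)
  have hae : ∀ {P : ℝ → Prop}, (∀ t ∈ Set.Ioi (0 : ℝ), P t) →
      ∀ᵐ t ∂(MeasureTheory.volume.restrict (Set.Ioi (0 : ℝ))), P t := fun h =>
    (MeasureTheory.ae_restrict_iff' measurableSet_Ioi).2 (Filter.Eventually.of_forall h)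
  refine (hasDerivAt_integral_of_dominated_loc_of_deriv_le
    (F' := fun z t => deriv (fun z => F z t) z) (bound := fun t => b t / (ε / 2))
    (Metric.ball_mem_nhds z₀ (half_pos hε)) ?_ ?_ ?_ ?_ ?_ ?_).2.differentiableAt.differentiableWithinAt
  · filter_upwards [hU.mem_nhds hz₀] with z hz using hmeas z hz
  · exact hbi.mono' (hmeas z₀ hz₀) (hae fun t ht => (hball z₀ (Metric.mem_ball_self hε)).1 t ht)
  · have hseq : Filter.Tendsto (fun n : ℕ => z₀ + (((ε / 2) * (1 / ((n : ℝ) + 1)) : ℝ) : ℂ)) Filter.atTop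
        (nhdsWithin z₀ {z₀}ᶜ) := by
      refine tendsto_nhdsWithin_iff.2 ⟨?_, Filter.Eventually.of_forall fun n => ?_⟩
      · have := (tendsto_one_div_add_atTop_nhds_zero_nat (𝕜 := ℝ)).const_mul (ε / 2)
        have := (Complex.continuous_ofReal.tendsto _).comp this
        simpa using this.const_add z₀
      · have : (0 : ℝ) < (ε / 2) * (1 / ((n : ℝ) + 1)) := by positivity
        simp only [Set.mem_compl_iff, Set.mem_singleton_iff, add_eq_left, Complex.ofReal_eq_zero]
        exact this.ne'
    refine aestronglyMeasurable_of_tendsto_ae Filter.atTop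
      (f := fun (n : ℕ) t => slope (fun z => F z t) z₀ (z₀ + (((ε / 2) * (1 / ((n : ℝ) + 1)) : ℝ) : ℂ)))
      (fun n => ?_) (hae fun t ht => ?_)
    · have : z₀ + (((ε / 2) * (1 / ((n : ℝ) + 1)) : ℝ) : ℂ) ∈ U := by
        refine (hball _ ?_).2
        rw [Metric.mem_ball, dist_eq_norm, add_sub_cancel_left, Complex.norm_real,
          Real.norm_of_nonneg (by positivity)]
        have : 1 / ((n : ℝ) + 1) ≤ 1 := by
          rw [div_le_one (by positivity)]; linarith [n.cast_nonneg (α := ℝ)]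
        nlinarith
      simp only [slope_def_field, div_eq_mul_inv]
      exact ((hmeas _ this).sub (hmeas _ hz₀)).mul_const _
    · exact (hasDerivAt_iff_tendsto_slope.1 (hda t ht z₀ hz₀).hasDerivAt).comp hseq
  · refine hae fun t ht z hz => ?_
    have hsub : Metric.closedBall z (ε / 2) ⊆ Metric.ball z₀ ε := by
      intro w hw
      have := dist_triangle w z z₀
      rw [Metric.mem_ball] at hz ⊢
      rw [Metric.mem_closedBall] at hw
      linarith
    refine Complex.norm_deriv_le_of_forall_mem_sphere_norm_le (half_pos hε) ?_ fun w hw => ?_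
    · refine DifferentiableOn.diffContOnCl fun w hw => ?_
      exact (hda t ht w (hball w (hsub (Metric.closure_ball_subset_closedBall hw))).2).differentiableWithinAt
    · exact (hball w (hsub (Metric.sphere_subset_closedBall hw))).1 t ht
  · exact hbi.div_const _
  · refine hae fun t ht z hz => (hda t ht z (hball z ?_).2).hasDerivAt
    exact Metric.ball_subset_ball (by linarith) hz

section Stieltjes

variable {m : Type*} [Fintype m] [DecidableEq m]

theorem integrableOn_rpow_div_add_one {p : ℝ} (hp : p ∈ Set.Ioo (0 : ℝ) 1) :
    MeasureTheory.IntegrableOn (fun t : ℝ => t ^ (p - 1) / (t + 1)) (Set.Ioi 0) :=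
  (Real.integrableOn_rpowIntegrand₀₁_Ioi hp zero_le_one).congr_fun
    (fun t ht => by
      beta_reduce
      rw [Real.rpowIntegrand₀₁_eq_pow_div hp (le_of_lt ht) zero_le_one, mul_one])
    measurableSet_Ioi

/-- The integrand of the matrix Stieltjes transform. -/
noncomputable def stieltjesKernel (p : ℝ) (E D : Matrix m m ℂ) (t : ℝ) : Matrix m m ℂ :=
  ((t ^ (p - 1) : ℝ) : ℂ) • (E * (E + (t : ℂ) • D)⁻¹)

/-- The matrix Stieltjes transform `∫ t ^ (p - 1) E (E + t D)⁻¹ dt` over `(0, ∞)`. -/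
noncomputable def stieltjes (p : ℝ) (E D : Matrix m m ℂ) : Matrix m m ℂ :=
  Matrix.of fun i j => ∫ t in Set.Ioi (0 : ℝ), stieltjesKernel p E D t i j

theorem differentiableAt_det {E : ℂ → Matrix m m ℂ} {z : ℂ}
    (hE : ∀ i j, DifferentiableAt ℂ (fun z => E z i j) z) :
    DifferentiableAt ℂ (fun z => (E z).det) z := by
  simp only [Matrix.det_apply']
  exact DifferentiableAt.fun_sum fun σ _ =>
    (DifferentiableAt.fun_finsetProd fun i _ => hE _ _).const_mul _

theorem continuousAt_det {X : Type*} [TopologicalSpace X] {E : X → Matrix m m ℂ} {z : X}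
    (hE : ∀ i j, ContinuousAt (fun z => E z i j) z) : ContinuousAt (fun z => (E z).det) z := by
  simp only [Matrix.det_apply']
  exact tendsto_finsetSum _ fun σ _ =>
    (tendsto_finsetProd _ fun i _ => hE _ _).const_mul _

theorem inv_apply_eq_div_det (A : Matrix m m ℂ) (i j : m) :
    A⁻¹ i j = (A.updateRow j (Pi.single i 1)).det / A.det := by
  rw [Matrix.inv_def, Ring.inverse_eq_inv', Matrix.smul_apply, adjugate_apply, smul_eq_mul,
    div_eq_inv_mul]

theorem differentiableAt_inv_apply {E : ℂ → Matrix m m ℂ} {z : ℂ}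
    (hE : ∀ i j, DifferentiableAt ℂ (fun z => E z i j) z) (hu : IsUnit (E z).det) (i j : m) :
    DifferentiableAt ℂ (fun z => (E z)⁻¹ i j) z := by
  simp only [inv_apply_eq_div_det]
  refine (differentiableAt_det fun k l => ?_).div (differentiableAt_det hE) hu.ne_zero
  by_cases h : k = j
  · subst h; simp
  · simpa [updateRow_ne h] using hE k l

theorem continuousAt_inv_apply {X : Type*} [TopologicalSpace X] {E : X → Matrix m m ℂ} {z : X}
    (hE : ∀ i j, ContinuousAt (fun z => E z i j) z) (hu : IsUnit (E z).det) (i j : m) :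
    ContinuousAt (fun z => (E z)⁻¹ i j) z := by
  simp only [inv_apply_eq_div_det]
  refine (continuousAt_det fun k l => ?_).div₀ (continuousAt_det hE) hu.ne_zero
  by_cases h : k = j
  · subst h; simpa using continuousAt_const
  · simpa [updateRow_ne h] using hE k l

theorem norm_stieltjesKernel_le {p η B : ℝ} {E D : Matrix m m ℂ} (hη : 0 < η)
    (hE : ∀ v, η * ‖v‖ ^ 2 ≤ (qform E v).re) (hD : ∀ v, η * ‖v‖ ^ 2 ≤ (qform D v).re)
    (i j : m) (hB : ∑ k, ‖E i k‖ ≤ B) {t : ℝ} (ht : 0 < t) :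
    ‖stieltjesKernel p E D t i j‖ ≤ B * η⁻¹ * (t ^ (p - 1) / (t + 1)) := by
  have hp : 0 ≤ t ^ (p - 1) := by positivity
  rw [stieltjesKernel, Matrix.smul_apply, smul_eq_mul, norm_mul, Complex.norm_real, Real.norm_of_nonneg hp,
    Matrix.mul_apply]
  have h1 : ∀ k, ‖(E + (t : ℂ) • D)⁻¹ k j‖ ≤ (η * (t + 1))⁻¹ := by
    intro k
    refine norm_inv_apply_le (by positivity) (fun v => ?_) k j
    rw [qform_add, qform_smul, Complex.add_re, Complex.re_ofReal_mul]
    have := mul_le_mul_of_nonneg_left (hD v) ht.le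
    linarith [hE v]
  have h2 : ‖∑ k, E i k * (E + (t : ℂ) • D)⁻¹ k j‖ ≤ B * (η * (t + 1))⁻¹ := by
    refine le_trans ?_ (mul_le_mul_of_nonneg_right hB (by positivity))
    rw [Finset.sum_mul]
    refine (norm_sum_le _ _).trans (Finset.sum_le_sum fun k _ => ?_)
    rw [norm_mul]; exact mul_le_mul_of_nonneg_left (h1 k) (norm_nonneg _)
  calc _ ≤ t ^ (p - 1) * (B * (η * (t + 1))⁻¹) := mul_le_mul_of_nonneg_left h2 hp
    _ = _ := by field_simp

theorem continuousOn_stieltjesKernel (p : ℝ) {E D : Matrix m m ℂ} (hE : Accretive E)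
    (hD : Accretive D) (i j : m) :
    ContinuousOn (fun t => stieltjesKernel p E D t i j) (Set.Ioi 0) := by
  intro t ht
  refine ContinuousAt.continuousWithinAt ?_
  have h : ∀ k, ContinuousAt (fun t : ℝ => (E + (t : ℂ) • D)⁻¹ k j) t := fun k => by
    refine continuousAt_inv_apply (E := fun t : ℝ => E + (t : ℂ) • D) (fun i j => ?_) (hE.add (hD.smul ht)).isUnit_det k j
    simp only [Matrix.add_apply, Matrix.smul_apply]
    fun_prop
  simp only [stieltjesKernel, Matrix.smul_apply, Matrix.mul_apply, smul_eq_mul]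
  refine ContinuousAt.mul ?_ ?_
  · exact Complex.continuous_ofReal.continuousAt.comp (Real.continuousAt_rpow_const _ _ (Or.inl (ne_of_gt ht)))
  · fun_prop

theorem integrableOn_stieltjesKernel {p : ℝ} (hp : p ∈ Set.Ioo (0 : ℝ) 1) {E D : Matrix m m ℂ}
    (hE : Accretive E) (hD : Accretive D) (i j : m) :
    MeasureTheory.IntegrableOn (fun t => stieltjesKernel p E D t i j) (Set.Ioi 0) := by
  obtain ⟨η, hη, h1⟩ := hE.exists_lower_bound
  obtain ⟨η', hη', h2⟩ := hD.exists_lower_bound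
  refine ((integrableOn_rpow_div_add_one hp).const_mul ((∑ k, ‖E i k‖) * (min η η')⁻¹)).mono'
    ((continuousOn_stieltjesKernel p hE hD i j).aestronglyMeasurable measurableSet_Ioi)
    ((MeasureTheory.ae_restrict_iff' measurableSet_Ioi).2 (Filter.Eventually.of_forall fun t ht => ?_))
  refine norm_stieltjesKernel_le (lt_min hη hη') (fun v => ?_) (fun v => ?_) i j le_rfl ht
  · exact (mul_le_mul_of_nonneg_right (min_le_left _ _) (sq_nonneg _)).trans (h1 v)
  · exact (mul_le_mul_of_nonneg_right (min_le_right _ _) (sq_nonneg _)).trans (h2 v)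

theorem differentiableOn_stieltjes {p : ℝ} (hp : p ∈ Set.Ioo (0 : ℝ) 1) {E D : ℂ → Matrix m m ℂ}
    {U : Set ℂ} (hU : IsOpen U) (hEd : ∀ i j, DifferentiableOn ℂ (fun z => E z i j) U)
    (hDd : ∀ i j, DifferentiableOn ℂ (fun z => D z i j) U) (hE : ∀ z ∈ U, Accretive (E z))
    (hD : ∀ z ∈ U, Accretive (D z)) (i j : m) :
    DifferentiableOn ℂ (fun z => stieltjes p (E z) (D z) i j) U := by
  have hEa : ∀ z ∈ U, ∀ i j, DifferentiableAt ℂ (fun z => E z i j) z :=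
    fun z hz i j => (hEd i j).differentiableAt (hU.mem_nhds hz)
  have hDa : ∀ z ∈ U, ∀ i j, DifferentiableAt ℂ (fun z => D z i j) z :=
    fun z hz i j => (hDd i j).differentiableAt (hU.mem_nhds hz)
  refine differentiableOn_setIntegral_Ioi hU (fun t ht z hz => ?_) (fun z hz =>
    continuousOn_stieltjesKernel p (hE z hz) (hD z hz) i j) fun z₀ hz₀ => ?_
  · refine DifferentiableAt.differentiableWithinAt ?_
    have h : ∀ k, DifferentiableAt ℂ (fun z => (E z + (t : ℂ) • D z)⁻¹ k j) z := fun k => by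
      refine differentiableAt_inv_apply (E := fun z => E z + (t : ℂ) • D z) (fun i j => ?_) ((hE z hz).add ((hD z hz).smul ht)).isUnit_det k j
      simp only [Matrix.add_apply, Matrix.smul_apply]
      exact (hEa z hz i j).add ((hDa z hz i j).const_mul _)
    simp only [stieltjesKernel, Matrix.smul_apply, Matrix.mul_apply, smul_eq_mul]
    refine DifferentiableAt.const_mul (DifferentiableAt.fun_sum fun k _ => (hEa z hz i k).mul (h k)) _
  · obtain ⟨η, hη, h1⟩ := (hE z₀ hz₀).eventually_lower_bound fun i j => (hEa z₀ hz₀ i j).continuousAt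
    obtain ⟨η', hη', h2⟩ := (hD z₀ hz₀).eventually_lower_bound fun i j => (hDa z₀ hz₀ i j).continuousAt
    have h3 : ∀ᶠ z in nhds z₀, ∑ k, ‖E z i k‖ < (∑ k, ‖E z₀ i k‖) + 1 := by
      have : ContinuousAt (fun z => ∑ k, ‖E z i k‖) z₀ :=
        tendsto_finsetSum _ fun k _ => (hEa z₀ hz₀ i k).continuousAt.norm
      exact this.eventually_lt continuousAt_const (lt_add_one _)
    refine ⟨_, (integrableOn_rpow_div_add_one hp).const_mul (((∑ k, ‖E z₀ i k‖) + 1) * (min η η')⁻¹), ?_⟩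
    filter_upwards [h1, h2, h3] with z h1 h2 h3 t ht
    refine norm_stieltjesKernel_le (lt_min hη hη') (fun v => ?_) (fun v => ?_) i j h3.le ht
    · exact (mul_le_mul_of_nonneg_right (min_le_left _ _) (sq_nonneg _)).trans (h1 v)
    · exact (mul_le_mul_of_nonneg_right (min_le_right _ _) (sq_nonneg _)).trans (h2 v)

end Stieltjes

theorem isOpen_re_pos : IsOpen {s : ℂ | 0 < s.re} :=
  isOpen_lt continuous_const Complex.continuous_re

theorem eqOn_re_pos_of_eq_ofReal {f g : ℂ → ℂ} (hf : DifferentiableOn ℂ f {s | 0 < s.re})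
    (hg : DifferentiableOn ℂ g {s | 0 < s.re}) (h : ∀ r : ℝ, 0 < r → f r = g r) :
    Set.EqOn f g {s | 0 < s.re} := by
  refine (hf.analyticOnNhd isOpen_re_pos).eqOn_of_preconnected_of_frequently_eq
    (hg.analyticOnNhd isOpen_re_pos) (convex_halfSpace_re_gt 0).isPreconnected
    (z₀ := 1) (by simp) ?_
  have hseq : Filter.Tendsto (fun n : ℕ => (1 : ℂ) + ((1 / ((n : ℝ) + 1) : ℝ) : ℂ)) Filter.atTop
      (nhdsWithin 1 {1}ᶜ) := by
    refine tendsto_nhdsWithin_iff.2 ⟨?_, Filter.Eventually.of_forall fun n => ?_⟩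
    · have := (Complex.continuous_ofReal.tendsto _).comp
        (tendsto_one_div_add_atTop_nhds_zero_nat (𝕜 := ℝ))
      simpa using this.const_add 1
    · have : (0 : ℝ) < 1 / ((n : ℝ) + 1) := by positivity
      simp only [Set.mem_compl_iff, Set.mem_singleton_iff, add_eq_left, Complex.ofReal_eq_zero]
      exact this.ne'
  refine hseq.frequently (Filter.Eventually.frequently (Filter.Eventually.of_forall fun n => ?_))
  have : (0 : ℝ) < 1 + 1 / ((n : ℝ) + 1) := by positivity
  exact_mod_cast h _ this

/-- The closed sector of half-opening `θ` about the positive real axis (for `θ < π / 2`, inside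
the right half-plane). -/
def InSector (θ : ℝ) (z : ℂ) : Prop :=
  0 ≤ (Complex.exp (θ * Complex.I) * z).im ∧ (Complex.exp (-θ * Complex.I) * z).im ≤ 0

section Stieltjes

variable {m : Type*} [Fintype m] [DecidableEq m]

theorem accretive_smul_one {z : ℂ} (hz : 0 < z.re) : Accretive (z • (1 : Matrix m m ℂ)) := fun v hv => by
  obtain ⟨h1, h2⟩ := (Matrix.PosDef.one (n := m) (R := ℂ)).qform_pos hv
  rw [qform_smul, Complex.mul_re, h2]
  simpa using mul_pos hz h1

theorem stieltjes_smul_one_of_pos (p : ℝ) (Y : Matrix m m ℂ) {c : ℝ} (hc : 0 < c) (i j : m) :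
    stieltjes p Y ((c : ℂ) • 1) i j = (c : ℂ) ^ (-p : ℂ) * stieltjes p Y 1 i j := by
  have h := MeasureTheory.integral_comp_mul_left_Ioi (fun t => stieltjesKernel p Y 1 t i j) 0 hc
  rw [mul_zero] at h
  simp only [stieltjes, Matrix.of_apply]
  have hp : (c : ℂ) ^ (-p : ℂ) = ((c ^ (1 - p) : ℝ) : ℂ) * ((c⁻¹ : ℝ) : ℂ) := by
    rw [← Complex.ofReal_neg, ← Complex.ofReal_cpow hc.le, ← Complex.ofReal_mul]
    congr 1
    rw [← Real.rpow_neg_one c, ← Real.rpow_add hc]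
    ring_nf
  rw [hp, mul_assoc, ← Complex.real_smul (x := c⁻¹), ← h, ← MeasureTheory.integral_const_mul]
  refine MeasureTheory.setIntegral_congr_fun measurableSet_Ioi fun t ht => ?_
  have ht : 0 < t := ht
  simp only [stieltjesKernel, Matrix.smul_apply, smul_eq_mul, smul_smul]
  rw [← mul_assoc, ← Complex.ofReal_mul, ← Complex.ofReal_mul, Real.mul_rpow hc.le ht.le, ← mul_assoc,
    ← Real.rpow_add hc, mul_comm c t]
  simp

theorem stieltjes_smul_one {p : ℝ} (hp : p ∈ Set.Ioo (0 : ℝ) 1) {Y : Matrix m m ℂ} (hY : Accretive Y)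
    {z : ℂ} (hz : 0 < z.re) : stieltjes p Y (z • 1) = z ^ (-p : ℂ) • stieltjes p Y 1 := by
  ext i j
  rw [Matrix.smul_apply, smul_eq_mul]
  refine eqOn_re_pos_of_eq_ofReal (f := fun z => stieltjes p Y (z • 1) i j)
    (g := fun z => z ^ (-p : ℂ) * stieltjes p Y 1 i j) ?_ ?_
    (fun c hc => stieltjes_smul_one_of_pos p Y hc i j) hz
  · refine differentiableOn_stieltjes hp isOpen_re_pos (fun i j => ?_) (fun i j => ?_)
      (fun z hz => hY) (fun z hz => accretive_smul_one hz) i j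
    · fun_prop
    · simp only [Matrix.smul_apply, smul_eq_mul]; fun_prop
  · intro z hz
    have : z ∈ Complex.slitPlane := Or.inl hz
    have h2 : DifferentiableAt ℂ (fun z : ℂ => z ^ (-p : ℂ)) z :=
      differentiableAt_id.cpow (differentiableAt_const _) this
    exact (h2.mul_const _).differentiableWithinAt

theorem qform_stieltjesKernel (p : ℝ) {E D : Matrix m m ℂ} (hE : Accretive E) (hD : Accretive D)
    {t : ℝ} (ht : 0 < t) (v : m → ℂ) :
    ∃ u, (v ≠ 0 → u ≠ 0) ∧ qform (stieltjesKernel p E D t) v = (t ^ (p - 1) : ℝ) *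
      (star (E *ᵥ u) ⬝ᵥ E *ᵥ u + t * (star (D *ᵥ u) ⬝ᵥ E *ᵥ u)) := by
  have hA := hE.add (hD.smul ht)
  refine ⟨(E + (t : ℂ) • D)⁻¹ *ᵥ v, hA.inv_mulVec_ne_zero, ?_⟩
  set u := (E + (t : ℂ) • D)⁻¹ *ᵥ v with hu
  have hv : v = E *ᵥ u + (t : ℂ) • D *ᵥ u := by
    rw [← smul_mulVec, ← add_mulVec, hu, mulVec_mulVec, hA.mul_inv_cancel, one_mulVec]
  rw [stieltjesKernel, qform_smul, qform, ← mulVec_mulVec, ← hu]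
  nth_rw 1 [hv]
  simp [add_dotProduct, smul_dotProduct]

theorem integrableOn_qform_stieltjesKernel {p : ℝ} (hp : p ∈ Set.Ioo (0 : ℝ) 1) {E D : Matrix m m ℂ}
    (hE : Accretive E) (hD : Accretive D) (v : m → ℂ) :
    MeasureTheory.IntegrableOn (fun t => qform (stieltjesKernel p E D t) v) (Set.Ioi 0) := by
  simp only [qform_eq_sum]
  exact MeasureTheory.integrable_finsetSum _ fun i _ => MeasureTheory.integrable_finsetSum _ fun j _ =>
    ((integrableOn_stieltjesKernel hp hE hD i j).mul_const _).const_mul _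

theorem qform_stieltjes {p : ℝ} (hp : p ∈ Set.Ioo (0 : ℝ) 1) {E D : Matrix m m ℂ}
    (hE : Accretive E) (hD : Accretive D) (v : m → ℂ) :
    qform (stieltjes p E D) v = ∫ t in Set.Ioi (0 : ℝ), qform (stieltjesKernel p E D t) v := by
  simp only [qform_eq_sum]
  have h : ∀ i j, MeasureTheory.IntegrableOn
      (fun t => star (v i) * (stieltjesKernel p E D t i j * v j)) (Set.Ioi 0) := fun i j =>
    ((integrableOn_stieltjesKernel hp hE hD i j).mul_const _).const_mul _
  rw [MeasureTheory.integral_finsetSum _ fun i _ => MeasureTheory.integrable_finsetSum _ fun j _ => h i j]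
  refine Finset.sum_congr rfl fun i _ => ?_
  rw [MeasureTheory.integral_finsetSum _ fun j _ => h i j]
  refine Finset.sum_congr rfl fun j _ => ?_
  rw [MeasureTheory.integral_const_mul, MeasureTheory.integral_mul_const]
  rfl

theorem accretive_stieltjes_one {p : ℝ} (hp : p ∈ Set.Ioo (0 : ℝ) 1) {Y : Matrix m m ℂ}
    (hY : Accretive Y) : Accretive (stieltjes p Y 1) := fun v hv => by
  have h1 : Accretive (1 : Matrix m m ℂ) := Matrix.PosDef.one.accretive
  have hi := integrableOn_qform_stieltjesKernel hp hY h1 v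
  have hpos : ∀ t ∈ Set.Ioi (0 : ℝ), 0 < (qform (stieltjesKernel p Y 1 t) v).re := fun t ht => by
    have ht : 0 < t := ht
    obtain ⟨u, hu, he⟩ := qform_stieltjesKernel p hY h1 ht v
    rw [he, Complex.re_ofReal_mul, Complex.add_re, Complex.re_ofReal_mul, one_mulVec]
    refine mul_pos (by positivity) (add_pos_of_nonneg_of_pos ?_ (mul_pos ht (hY u (hu hv))))
    exact (Complex.nonneg_iff.1 (dotProduct_star_self_nonneg (Y *ᵥ u))).1
  rw [qform_stieltjes hp hY h1]
  change 0 < RCLike.re (K := ℂ) _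
  rw [← integral_re hi]
  simp only [RCLike.re_to_complex]
  refine (MeasureTheory.setIntegral_pos_iff_support_of_nonneg_ae
    ((MeasureTheory.ae_restrict_iff' measurableSet_Ioi).2
      (Filter.Eventually.of_forall fun t ht => (hpos t ht).le)) hi.re).2 ?_
  have : Set.Ioi (0 : ℝ) ⊆ Function.support fun t => (qform (stieltjesKernel p Y 1 t) v).re :=
    fun t ht => (hpos t ht).ne'
  rw [Set.inter_eq_right.2 this]
  simp

theorem inSector_stieltjes_one {p θ : ℝ} (hp : p ∈ Set.Ioo (0 : ℝ) 1) (hθ : |θ| < Real.pi / 2)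
    {Y : Matrix m m ℂ} (hY : Accretive Y) (hs : ∀ v, InSector θ (qform Y v)) (v : m → ℂ) :
    InSector (p * θ) (qform (stieltjes p Y 1) v) := by
  have hre : ∀ φ : ℝ, |φ| < Real.pi / 2 → 0 < (Complex.exp (-φ * Complex.I)).re := fun φ hφ => by
    rw [← Complex.ofReal_neg, Complex.exp_ofReal_mul_I_re, Real.cos_neg]
    exact Real.cos_pos_of_mem_Ioo (abs_lt.1 hφ)
  have key : ∀ φ : ℝ, |φ| < Real.pi / 2 →
      (Complex.exp ((p * φ : ℝ) * Complex.I) * qform (stieltjes p Y 1) v).im =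
        ∫ t in Set.Ioi (0 : ℝ), (qform (stieltjesKernel p Y (Complex.exp (-φ * Complex.I) • 1) t) v).im := by
    intro φ hφ
    have h1 : Complex.exp (-φ * Complex.I) ^ (-p : ℂ) = Complex.exp ((p * φ : ℝ) * Complex.I) := by
      rw [Complex.cpow_def_of_ne_zero (Complex.exp_ne_zero _), Complex.log_exp]
      · congr 1; push_cast; ring
      · simp; linarith [(abs_lt.1 hφ).2, Real.pi_pos]
      · simp; linarith [(abs_lt.1 hφ).1, Real.pi_pos]
    rw [← h1, ← qform_smul, ← stieltjes_smul_one hp hY (hre φ hφ),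
      qform_stieltjes hp hY (accretive_smul_one (hre φ hφ))]
    exact (integral_im (𝕜 := ℂ)
      (integrableOn_qform_stieltjesKernel hp hY (accretive_smul_one (hre φ hφ)) v)).symm
  have hk : ∀ φ : ℝ, |φ| < Real.pi / 2 → ∀ t ∈ Set.Ioi (0 : ℝ), ∃ c : ℝ, 0 ≤ c ∧ ∃ u,
      (qform (stieltjesKernel p Y (Complex.exp (-φ * Complex.I) • 1) t) v).im =
        c * (Complex.exp (φ * Complex.I) * qform Y u).im := by
    intro φ hφ t ht
    have ht : 0 < t := ht
    obtain ⟨u, -, he⟩ := qform_stieltjesKernel p hY (accretive_smul_one (hre φ hφ)) ht v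
    have h1 : star ((Complex.exp (-φ * Complex.I) • (1 : Matrix m m ℂ)) *ᵥ u) ⬝ᵥ Y *ᵥ u =
        Complex.exp (φ * Complex.I) * qform Y u := by
      have : (starRingEnd ℂ) (Complex.exp (-φ * Complex.I)) = Complex.exp (φ * Complex.I) := by
        rw [← Complex.exp_conj]; simp
      rw [smul_mulVec, one_mulVec, star_smul, smul_dotProduct, smul_eq_mul, ← this]
      rfl
    have h2 : (star (Y *ᵥ u) ⬝ᵥ Y *ᵥ u).im = 0 :=
      (Complex.nonneg_iff.1 (dotProduct_star_self_nonneg (Y *ᵥ u))).2.symm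
    refine ⟨t ^ (p - 1) * t, by positivity, u, ?_⟩
    rw [he, h1, Complex.im_ofReal_mul, Complex.add_im, h2, Complex.im_ofReal_mul]
    ring
  constructor
  · rw [key θ hθ]
    refine MeasureTheory.setIntegral_nonneg measurableSet_Ioi fun t ht => ?_
    obtain ⟨c, hc, u, he⟩ := hk θ hθ t ht
    rw [he]
    exact mul_nonneg hc (hs u).1
  · have hθ' : |(-θ)| < Real.pi / 2 := by rwa [abs_neg]
    have h1 := key (-θ) hθ'
    rw [mul_neg, Complex.ofReal_neg] at h1
    rw [h1]
    refine MeasureTheory.setIntegral_nonpos measurableSet_Ioi fun t ht => ?_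
    obtain ⟨c, hc, u, he⟩ := hk (-θ) hθ' t ht
    rw [he, Complex.ofReal_neg]
    exact mul_nonpos_of_nonneg_of_nonpos hc (hs u).2

end Stieltjes

section UnitaryDiagonal

variable {m : Type*} [Fintype m] [DecidableEq m]

theorem exists_cfc_eq_unitary_conj {Y : Matrix m m ℂ} (hY : Y.PosDef) :
    ∃ (U : Matrix m m ℂ) (d : m → ℝ), star U * U = 1 ∧ U * star U = 1 ∧ (∀ i, 0 < d i) ∧
      ∀ f : ℝ → ℝ, cfc f Y = U * diagonal (fun i => (f (d i) : ℂ)) * star U := by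
  refine ⟨hY.isHermitian.eigenvectorUnitary, hY.isHermitian.eigenvalues, ?_, ?_, hY.eigenvalues_pos,
    fun f => ?_⟩
  · exact Unitary.coe_star_mul_self _
  · exact Unitary.coe_mul_star_self _
  · rw [hY.isHermitian.cfc_eq, IsHermitian.cfc, Unitary.conjStarAlgAut_apply]
    rfl

theorem unitary_conj_diagonal_apply (U : Matrix m m ℂ) (d : m → ℂ) (i j : m) :
    (U * diagonal d * star U) i j = ∑ k, d k * (U i k * star (U j k)) := by
  rw [Matrix.mul_apply]
  refine Finset.sum_congr rfl fun k _ => ?_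
  rw [mul_diagonal, star_apply]; ring

theorem cfc_rpow_eq_stieltjes {p : ℝ} (hp : p ∈ Set.Ioo (0 : ℝ) 1) {Y : Matrix m m ℂ} (hY : Y.PosDef) :
    ((∫ t in Set.Ioi (0 : ℝ), Real.rpowIntegrand₀₁ p t 1 : ℝ) : ℂ) • cfc (fun x : ℝ => x ^ p) Y
      = stieltjes p Y 1 := by
  obtain ⟨U, d, hU, hU', hd, hf⟩ := exists_cfc_eq_unitary_conj hY
  have hYe : Y = U * diagonal (fun i => (d i : ℂ)) * star U := by
    have := hf id
    rwa [cfc_id ℝ Y hY.isHermitian.isSelfAdjoint] at this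
  have hmul : ∀ a b : m → ℂ, (U * diagonal a * star U) * (U * diagonal b * star U) =
      U * diagonal (fun i => a i * b i) * star U := by
    intro a b
    rw [← diagonal_mul_diagonal]
    simp only [Matrix.mul_assoc]
    rw [← Matrix.mul_assoc (star U) U, hU, Matrix.one_mul]
  have hker : ∀ t : ℝ, 0 < t → Y * (Y + (t : ℂ) • 1)⁻¹ =
      U * diagonal (fun i => (d i : ℂ) / (t + d i)) * star U := by
    intro t ht
    have h0 : ∀ i, (t : ℂ) + d i ≠ 0 := fun i => by
      have := add_pos ht (hd i)
      exact_mod_cast this.ne'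
    have h1 : Y + (t : ℂ) • 1 = U * diagonal (fun i => (t : ℂ) + d i) * star U := by
      have : diagonal (fun i => (t : ℂ) + d i) =
          diagonal (fun i => (d i : ℂ)) + diagonal fun _ => (t : ℂ) := by
        rw [diagonal_add]; simp only [add_comm]
      rw [this, Matrix.mul_add, Matrix.add_mul, ← hYe, ← smul_one_eq_diagonal,
        Matrix.mul_smul, Matrix.mul_one, Matrix.smul_mul, hU']
    have h2 : (Y + (t : ℂ) • 1)⁻¹ = U * diagonal (fun i => ((t : ℂ) + d i)⁻¹) * star U := by
      refine inv_eq_right_inv ?_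
      rw [h1, hmul]
      simp only [mul_inv_cancel₀ (h0 _)]
      rw [diagonal_one, Matrix.mul_one, hU']
    rw [h2]
    nth_rw 1 [hYe]
    rw [hmul]
    rfl
  ext i j
  rw [hf, Matrix.smul_apply, unitary_conj_diagonal_apply, smul_eq_mul, Finset.mul_sum, stieltjes, Matrix.of_apply]
  have hintegral : ∀ k, ((∫ t in Set.Ioi (0 : ℝ), Real.rpowIntegrand₀₁ p t 1 : ℝ) : ℂ) * (d k ^ p : ℝ) =
      ∫ t in Set.Ioi (0 : ℝ), ((Real.rpowIntegrand₀₁ p t (d k) : ℝ) : ℂ) := fun k => by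
    refine Eq.trans ?_ (integral_ofReal (𝕜 := ℂ)
      (f := fun t => Real.rpowIntegrand₀₁ p t (d k))).symm
    rw [Real.integral_rpowIntegrand₀₁_eq_rpow_mul_const hp (hd k).le, ← Complex.ofReal_mul,
      mul_comm]
    rfl
  simp only [← mul_assoc _ _ (U i _ * star (U j _)), hintegral, ← MeasureTheory.integral_mul_const]
  rw [← MeasureTheory.integral_finsetSum]
  · refine MeasureTheory.setIntegral_congr_fun measurableSet_Ioi fun t ht => ?_
    have ht : 0 < t := ht
    rw [stieltjesKernel, hker t ht, Matrix.smul_apply, unitary_conj_diagonal_apply, smul_eq_mul, Finset.mul_sum]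
    refine Finset.sum_congr rfl fun k _ => ?_
    rw [Real.rpowIntegrand₀₁_eq_pow_div hp ht.le (hd k).le]
    push_cast
    ring
  · intro k _
    exact (Real.integrableOn_rpowIntegrand₀₁_Ioi hp (hd k).le).ofReal.mul_const _

end UnitaryDiagonal

section Sector

theorem inSector_iff {θ : ℝ} {z : ℂ} :
    InSector θ z ↔ 0 ≤ z.re * Real.sin θ + z.im * Real.cos θ ∧
      z.im * Real.cos θ ≤ z.re * Real.sin θ := by
  have h1 : (Complex.exp (θ * Complex.I) * z).im = z.re * Real.sin θ + z.im * Real.cos θ := by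
    rw [Complex.mul_im, Complex.exp_ofReal_mul_I_re, Complex.exp_ofReal_mul_I_im]
    ring
  have h2 : (Complex.exp (-θ * Complex.I) * z).im = z.im * Real.cos θ - z.re * Real.sin θ := by
    rw [← Complex.ofReal_neg, Complex.mul_im, Complex.exp_ofReal_mul_I_re,
      Complex.exp_ofReal_mul_I_im, Real.cos_neg, Real.sin_neg]
    ring
  rw [InSector, h1, h2, sub_nonpos]

theorem inSector_zero (θ : ℝ) : InSector θ 0 := by simp [InSector]

theorem InSector.add {θ : ℝ} {z w : ℂ} (hz : InSector θ z) (hw : InSector θ w) :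
    InSector θ (z + w) := by
  rw [InSector, mul_add, mul_add, Complex.add_im, Complex.add_im]
  exact ⟨add_nonneg hz.1 hw.1, add_nonpos hz.2 hw.2⟩

theorem InSector.multiset_sum {θ : ℝ} {s : Multiset ℂ} (h : ∀ z ∈ s, InSector θ z) :
    InSector θ s.sum :=
  Multiset.sum_induction _ s (fun _ _ => InSector.add) (inSector_zero θ) h

theorem InSector.ofReal_mul {θ r : ℝ} {z : ℂ} (hr : 0 ≤ r) (hz : InSector θ z) :
    InSector θ (r * z) := by
  rw [InSector, mul_left_comm, mul_left_comm _ (r : ℂ), Complex.im_ofReal_mul,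
    Complex.im_ofReal_mul]
  exact ⟨mul_nonneg hr hz.1, mul_nonpos_of_nonneg_of_nonpos hr hz.2⟩

theorem inSector_star {θ : ℝ} {z : ℂ} (hz : InSector θ z) : InSector θ (star z) := by
  rw [inSector_iff] at *
  simp only [Complex.star_def, Complex.conj_re, Complex.conj_im]
  constructor <;> linarith

theorem inSector_iff_abs_arg_le {θ : ℝ} (h0 : 0 ≤ θ) (hθ : θ < Real.pi / 2) {z : ℂ}
    (hz : 0 < z.re) : InSector θ z ↔ |z.arg| ≤ θ := by
  have hz0 : z ≠ 0 := fun h => by simp [h] at hz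
  have hn : 0 < ‖z‖ := norm_pos_iff.2 hz0
  have harg := abs_lt.1 (Complex.abs_arg_lt_pi_div_two_iff.2 (Or.inl hz))
  have hre : z.re = ‖z‖ * Real.cos z.arg := (Complex.norm_mul_cos_arg z).symm
  have him : z.im = ‖z‖ * Real.sin z.arg := (Complex.norm_mul_sin_arg z).symm
  have h1 : z.re * Real.sin θ + z.im * Real.cos θ = ‖z‖ * Real.sin (θ + z.arg) := by
    rw [hre, him, Real.sin_add]; ring
  have h2 : z.re * Real.sin θ - z.im * Real.cos θ = ‖z‖ * Real.sin (θ - z.arg) := by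
    rw [hre, him, Real.sin_sub]; ring
  have key : ∀ x : ℝ, -Real.pi < x → x < Real.pi → (0 ≤ ‖z‖ * Real.sin x ↔ 0 ≤ x) := by
    intro x hx hx'
    rw [mul_nonneg_iff_of_pos_left hn]
    exact ⟨fun h => not_lt.1 fun hneg => not_lt.2 h (Real.sin_neg_of_neg_of_neg_pi_lt hneg hx),
      fun h => Real.sin_nonneg_of_nonneg_of_le_pi h hx'.le⟩
  rw [inSector_iff, ← sub_nonneg (a := z.re * Real.sin θ), h1, h2, key _ (by linarith) (by linarith),
    key _ (by linarith) (by linarith), abs_le]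
  constructor <;> rintro ⟨h3, h4⟩ <;> constructor <;> linarith

theorem InSector.abs_im_mul_re_le {σ z : ℂ} (hσ : 0 < σ.re) (hz : InSector |σ.arg| z) :
    |z.im| * σ.re ≤ z.re * |σ.im| := by
  have hσ0 : σ ≠ 0 := fun h => by simp [h] at hσ
  have hn : 0 < ‖σ‖ := norm_pos_iff.2 hσ0
  have hcos : Real.cos |σ.arg| = σ.re / ‖σ‖ := by rw [Real.cos_abs, Complex.cos_arg hσ0]
  have hsin : Real.sin |σ.arg| = |σ.im| / ‖σ‖ := by
    rw [← Real.abs_sin_eq_sin_abs_of_abs_le_pi (Complex.abs_arg_le_pi σ), Complex.sin_arg, abs_div,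
      abs_of_pos hn]
  rw [inSector_iff, hcos, hsin] at hz
  obtain ⟨h1, h2⟩ := hz
  have e1 : z.re * (|σ.im| / ‖σ‖) + z.im * (σ.re / ‖σ‖) = (z.re * |σ.im| + z.im * σ.re) / ‖σ‖ := by
    ring
  have h1 : 0 ≤ z.re * |σ.im| + z.im * σ.re := by
    have := mul_nonneg h1 hn.le
    rwa [e1, div_mul_cancel₀ _ hn.ne'] at this
  rw [← mul_div_assoc, ← mul_div_assoc, div_le_div_iff_of_pos_right hn] at h2
  rcases abs_cases z.im with ⟨h, _⟩ | ⟨h, _⟩ <;> rw [h] <;> linarith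

theorem inSector_joukowski {σ : ℂ} (hσ : 0 < σ.re) {a b : ℝ} (ha : 0 ≤ a) (hb : 0 ≤ b) :
    InSector |σ.arg| (σ * a + σ⁻¹ * b) := by
  have hlt := Complex.abs_arg_lt_pi_div_two_iff.2 (Or.inl hσ)
  have hσ' : 0 < (σ⁻¹).re := by
    rw [Complex.inv_re]
    have hσ0 : σ ≠ 0 := fun h => by simp [h] at hσ
    exact div_pos hσ (Complex.normSq_pos.2 hσ0)
  rw [mul_comm, mul_comm _ (b : ℂ)]
  exact (((inSector_iff_abs_arg_le (abs_nonneg _) hlt hσ).2 le_rfl).ofReal_mul ha).add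
    (((inSector_iff_abs_arg_le (abs_nonneg _) hlt hσ').2 (Complex.abs_arg_inv σ).le).ofReal_mul hb)

end Sector

section Roots

open Polynomial in
theorem roots_charpoly_inv_add_smul_one {m : Type*} [Fintype m] [DecidableEq m] (T : Matrix m m ℂ) {t : ℂ}
    (ht : IsUnit (T + t • (1 : Matrix m m ℂ)).det) :
    ((T + t • (1 : Matrix m m ℂ))⁻¹).charpoly.roots = T.charpoly.roots.map fun μ => (μ + t)⁻¹ := by
  set R := (T + t • (1 : Matrix m m ℂ))⁻¹ with hR
  have hcard : T.charpoly.roots.card = Fintype.card m := by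
    rw [← (IsAlgClosed.splits T.charpoly).natDegree_eq_card_roots, T.charpoly_natDegree_eq_dim]
  have hchar : ∀ x : ℂ, (x • (1 : Matrix m m ℂ) - T).det = (T.charpoly.roots.map fun μ => x - μ).prod := by
    intro x
    rw [← (IsAlgClosed.splits T.charpoly).eval_eq_prod_roots_of_monic T.charpoly_monic, eval_charpoly,
      scalar_apply, smul_one_eq_diagonal]
  have hdet : ∀ x : ℂ, (T + x • (1 : Matrix m m ℂ)).det = (T.charpoly.roots.map fun μ => μ + x).prod := by
    intro x
    have h1 : T + x • (1 : Matrix m m ℂ) = -((-x) • (1 : Matrix m m ℂ) - T) := by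
      rw [neg_smul]; abel
    rw [h1, det_neg, hchar, ← hcard, ← Multiset.card_map (fun μ => -x - μ), ← Multiset.prod_map_neg,
      Multiset.map_map]
    congr 1
    refine Multiset.map_congr rfl fun μ _ => ?_
    simp only [Function.comp_apply]
    ring
  have hne : ∀ μ ∈ T.charpoly.roots, μ + t ≠ 0 := by
    intro μ hμ h0
    rw [hdet] at ht
    exact ht.ne_zero (Multiset.prod_eq_zero (h0 ▸ Multiset.mem_map_of_mem (fun μ => μ + t) hμ))
  have hpoly : R.charpoly = ((T.charpoly.roots.map fun μ => (μ + t)⁻¹).map fun a => X - C a).prod := by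
    refine eq_of_infinite_eval_eq _ _ (Set.Infinite.mono (s := {0}ᶜ) ?_ (Set.finite_singleton 0).infinite_compl)
    intro x hx
    have hx : x ≠ 0 := hx
    have hRT : R * (T + t • (1 : Matrix m m ℂ)) = 1 := nonsing_inv_mul _ ht
    have e1 : x • (1 : Matrix m m ℂ) - R = R * (x • (T + (t - x⁻¹) • (1 : Matrix m m ℂ))) := by
      have e2 : x • (T + (t - x⁻¹) • (1 : Matrix m m ℂ)) =
          x • (T + t • (1 : Matrix m m ℂ)) - 1 := by
        rw [sub_smul, ← add_sub_assoc, smul_sub, smul_smul, mul_inv_cancel₀ hx, one_smul]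
      rw [e2, Matrix.mul_sub, Matrix.mul_smul, hRT, Matrix.mul_one]
    have hdetR : R.det = (T.charpoly.roots.map fun μ => (μ + t)⁻¹).prod := by
      rw [Multiset.prod_map_inv, ← hdet, hR, det_nonsing_inv, Ring.inverse_eq_inv]
    have hpow : x ^ Fintype.card m = (T.charpoly.roots.map fun _ => x).prod := by
      rw [Multiset.map_const', Multiset.prod_replicate, hcard]
    rw [Set.mem_ofPred_eq, eval_charpoly, scalar_apply, ← smul_one_eq_diagonal, e1, det_mul, det_smul, hdet,
      hdetR, hpow, ← Multiset.prod_map_mul, ← Multiset.prod_map_mul, eval_multiset_prod,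
      Multiset.map_map, Multiset.map_map]
    congr 1
    refine Multiset.map_congr rfl fun μ hμ => ?_
    have := hne μ hμ
    simp only [Function.comp_apply, eval_sub, eval_X, eval_C]
    field_simp
    ring
  rw [hpoly, roots_multiset_prod_X_sub_C]

end Roots

section Trace

open MeasureTheory

/-- The normalising constant `∫ t ^ (p - 1) / (t + 1)` over `(0, ∞)`. -/
noncomputable def rpowConst (p : ℝ) : ℝ := ∫ t in Set.Ioi (0 : ℝ), Real.rpowIntegrand₀₁ p t 1

theorem rpowConst_pos {p : ℝ} (hp : p ∈ Set.Ioo (0 : ℝ) 1) : 0 < rpowConst p :=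
  Real.integral_rpowIntegrand₀₁_one_pos hp

theorem integrableOn_and_integral_cpow {p : ℝ} (hp : p ∈ Set.Ioo (0 : ℝ) 1) {μ : ℂ}
    (hμ : μ ∈ Complex.slitPlane) :
    IntegrableOn (fun t : ℝ => ((t ^ (p - 1) : ℝ) : ℂ) * (μ / (μ + t))) (Set.Ioi 0) ∧
      ∫ t in Set.Ioi (0 : ℝ), ((t ^ (p - 1) : ℝ) : ℂ) * (μ / (μ + t)) = rpowConst p * μ ^ (p : ℂ) := by
  have hμ0 := Complex.slitPlane_ne_zero hμ
  have hker : ∀ ν : ℂ, ν ≠ 0 → ∀ t : ℝ, stieltjesKernel p (ν • (1 : Matrix Unit Unit ℂ)) (ν⁻¹ • 1) t () () =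
      ((t ^ (p - 1) : ℝ) : ℂ) * (ν ^ 2 / (ν ^ 2 + t)) := by
    intro ν hν t
    have h1 : ν • (1 : Matrix Unit Unit ℂ) + (t : ℂ) • ν⁻¹ • 1 = diagonal fun _ => ν + t * ν⁻¹ := by
      rw [smul_smul, ← add_smul, smul_one_eq_diagonal]
    have h2 : ν + t * ν⁻¹ = (ν ^ 2 + t) / ν := by field_simp
    rw [stieltjesKernel, h1, inv_subsingleton, smul_one_eq_diagonal, diagonal_mul_diagonal,
      Matrix.smul_apply, diagonal_apply_eq, diagonal_apply_eq, smul_eq_mul, Ring.inverse_eq_inv', h2,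
      inv_div, ← mul_div_assoc, sq]
  set F : ℂ → ℂ := fun ν => stieltjes p (ν • (1 : Matrix Unit Unit ℂ)) (ν⁻¹ • 1) () () with hF
  have hne : ∀ ν : ℂ, 0 < ν.re → ν ≠ 0 := fun ν hν h => by simp [h] at hν
  have hinv : ∀ ν : ℂ, 0 < ν.re → 0 < (ν⁻¹).re := fun ν hν => by
    rw [Complex.inv_re]
    exact div_pos hν (Complex.normSq_pos.2 (hne ν hν))
  have hFd : DifferentiableOn ℂ F {s | 0 < s.re} := by
    refine differentiableOn_stieltjes hp isOpen_re_pos ?_ ?_ (fun s hs => accretive_smul_one hs)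
      (fun s hs => accretive_smul_one (hinv s hs)) () ()
    · intro i j
      simp only [Matrix.smul_apply, smul_eq_mul]
      fun_prop
    · intro i j
      simp only [Matrix.smul_apply, smul_eq_mul]
      exact (differentiableOn_id.inv fun s hs => hne s hs).mul_const _
  have hFeq : Set.EqOn F (fun ν => rpowConst p * ν ^ (2 * p : ℂ)) {s | 0 < s.re} := by
    refine eqOn_re_pos_of_eq_ofReal hFd ?_ ?_
    · refine DifferentiableOn.const_mul ?_ _
      exact fun s hs => (DifferentiableAt.cpow differentiableAt_id (differentiableAt_const _)
        (Or.inl hs)).differentiableWithinAt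
    · intro r hr
      have hr2 : 0 ≤ r ^ 2 := by positivity
      have : ∀ t ∈ Set.Ioi (0 : ℝ), stieltjesKernel p ((r : ℂ) • (1 : Matrix Unit Unit ℂ)) ((r : ℂ)⁻¹ • 1) t () () =
          ((Real.rpowIntegrand₀₁ p t (r ^ 2) : ℝ) : ℂ) := by
        intro t ht
        rw [hker _ (by exact_mod_cast hr.ne'), Real.rpowIntegrand₀₁_eq_pow_div hp (le_of_lt ht) hr2]
        push_cast
        rw [mul_div_assoc, add_comm]
      simp only [hF, stieltjes, Matrix.of_apply]
      rw [setIntegral_congr_fun measurableSet_Ioi this]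
      refine (integral_ofReal (𝕜 := ℂ) (f := fun t => Real.rpowIntegrand₀₁ p t (r ^ 2))).trans ?_
      rw [Real.integral_rpowIntegrand₀₁_eq_rpow_mul_const hp hr2, mul_comm, ← Real.rpow_natCast,
        ← Real.rpow_mul hr.le]
      change ((rpowConst p * r ^ (((2 : ℕ) : ℝ) * p) : ℝ) : ℂ) = _
      rw [Complex.ofReal_mul, Complex.ofReal_cpow hr.le]
      push_cast
      rfl
  set ν := Complex.exp (Complex.log μ / 2) with hν
  have hlogim : (Complex.log μ / 2).im = μ.arg / 2 := by
    rw [Complex.div_ofNat_im, Complex.log_im]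
  have harg := (Complex.mem_slitPlane_iff_arg.1 hμ).1
  have harg1 := lt_of_le_of_ne (Complex.arg_le_pi μ) harg
  have harg2 := Complex.neg_pi_lt_arg μ
  have hνre : 0 < ν.re := by
    rw [hν, Complex.exp_re, hlogim]
    exact mul_pos (Real.exp_pos _) (Real.cos_pos_of_mem_Ioo ⟨by linarith, by linarith⟩)
  have hν2 : ν ^ 2 = μ := by
    rw [hν, ← Complex.exp_nat_mul]
    push_cast
    rw [mul_div_cancel₀ _ two_ne_zero, Complex.exp_log hμ0]
  have hpow : ν ^ (2 * p : ℂ) = μ ^ (p : ℂ) := by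
    rw [Complex.cpow_def_of_ne_zero (hne ν hνre), Complex.cpow_def_of_ne_zero hμ0, hν,
      Complex.log_exp (by rw [hlogim]; linarith) (by rw [hlogim]; linarith)]
    congr 1
    ring
  have hk : (fun t : ℝ => ((t ^ (p - 1) : ℝ) : ℂ) * (μ / (μ + t))) =
      fun t => stieltjesKernel p (ν • (1 : Matrix Unit Unit ℂ)) (ν⁻¹ • 1) t () () := by
    funext t
    rw [hker ν (hne ν hνre), hν2]
  rw [hk, ← hpow]
  exact ⟨integrableOn_stieltjesKernel hp (accretive_smul_one hνre) (accretive_smul_one (hinv ν hνre)) () (),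
    hFeq hνre⟩

theorem trace_stieltjes {m : Type*} [Fintype m] [DecidableEq m] {p : ℝ} (hp : p ∈ Set.Ioo (0 : ℝ) 1)
    {N X : Matrix m m ℂ} (hN : Accretive N) (hX : Accretive X)
    (hroots : ∀ μ ∈ (X * N).charpoly.roots, μ ∈ Complex.slitPlane) :
    (stieltjes p N X⁻¹).trace = rpowConst p * ((X * N).charpoly.roots.map fun μ => μ ^ (p : ℂ)).sum := by
  set T := X * N with hT
  have hcard : T.charpoly.roots.card = Fintype.card m := by
    rw [← (IsAlgClosed.splits T.charpoly).natDegree_eq_card_roots, T.charpoly_natDegree_eq_dim]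
  have hker : ∀ t ∈ Set.Ioi (0 : ℝ), ∑ i, stieltjesKernel p N X⁻¹ t i i =
      (T.charpoly.roots.map fun μ => ((t ^ (p - 1) : ℝ) : ℂ) * (μ / (μ + t))).sum := by
    intro t ht
    have hacc : Accretive (N + (t : ℂ) • X⁻¹) := hN.add (hX.inv.smul ht)
    have e1 : T + (t : ℂ) • (1 : Matrix m m ℂ) = X * (N + (t : ℂ) • X⁻¹) := by
      rw [Matrix.mul_add, Matrix.mul_smul, hX.mul_inv_cancel]
    have hu : IsUnit (T + (t : ℂ) • (1 : Matrix m m ℂ)).det := by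
      rw [e1, det_mul]
      exact hX.isUnit_det.mul hacc.isUnit_det
    have e2 : (N + (t : ℂ) • X⁻¹)⁻¹ = (T + (t : ℂ) • (1 : Matrix m m ℂ))⁻¹ * X := by
      refine inv_eq_left_inv ?_
      rw [Matrix.mul_assoc, ← e1, nonsing_inv_mul _ hu]
    have e3 : T * (T + (t : ℂ) • (1 : Matrix m m ℂ))⁻¹ = 1 - (t : ℂ) • (T + (t : ℂ) • (1 : Matrix m m ℂ))⁻¹ := by
      rw [eq_sub_iff_add_eq, ← Matrix.one_mul (M := (T + (t : ℂ) • (1 : Matrix m m ℂ))⁻¹), ← Matrix.smul_mul,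
        ← Matrix.mul_assoc, Matrix.mul_one, ← Matrix.add_mul, mul_nonsing_inv _ hu]
    have hne : ∀ μ ∈ T.charpoly.roots, μ + t ≠ 0 := by
      intro μ hμ h0
      have := hroots μ hμ
      rw [eq_neg_of_add_eq_zero_left h0, Complex.mem_slitPlane_iff] at this
      have ht : (0 : ℝ) < t := ht
      simp at this
      linarith
    have e4 : (N * (N + (t : ℂ) • X⁻¹)⁻¹).trace = (T.charpoly.roots.map fun μ : ℂ => μ / (μ + (t : ℂ))).sum := by
      rw [e2, ← Matrix.mul_assoc, trace_mul_comm, ← Matrix.mul_assoc, ← hT, e3, trace_sub, trace_one, trace_smul,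
        trace_eq_sum_roots_charpoly, roots_charpoly_inv_add_smul_one T hu, smul_eq_mul,
        ← Multiset.sum_map_mul_left]
      have : (Fintype.card m : ℂ) = (T.charpoly.roots.map fun _ => (1 : ℂ)).sum := by
        rw [Multiset.map_const', Multiset.sum_replicate, hcard, nsmul_one]
      rw [this, ← Multiset.sum_map_sub]
      refine congrArg _ (Multiset.map_congr rfl fun μ hμ => ?_)
      have := hne μ hμ
      field_simp
      ring
    rw [Multiset.sum_map_mul_left, ← e4, trace, Finset.mul_sum]
    rfl
  have hmulti : ∀ s : Multiset ℂ, (∀ μ ∈ s, μ ∈ Complex.slitPlane) →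
      IntegrableOn (fun t : ℝ => (s.map fun μ => ((t ^ (p - 1) : ℝ) : ℂ) * (μ / (μ + t))).sum) (Set.Ioi 0) ∧
      ∫ t in Set.Ioi (0 : ℝ), (s.map fun μ => ((t ^ (p - 1) : ℝ) : ℂ) * (μ / (μ + t))).sum =
        rpowConst p * (s.map fun μ => μ ^ (p : ℂ)).sum := by
    intro s
    induction s using Multiset.induction_on with
    | empty => simp
    | cons a s ih =>
      intro hs
      obtain ⟨i1, i2⟩ := ih fun μ hμ => hs μ (Multiset.mem_cons_of_mem hμ)
      obtain ⟨j1, j2⟩ := integrableOn_and_integral_cpow hp (hs a (Multiset.mem_cons_self a s))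
      simp only [Multiset.map_cons, Multiset.sum_cons]
      exact ⟨j1.add i1, by rw [integral_add j1 i1, i2, j2, mul_add]⟩
  rw [← (hmulti _ hroots).2, ← setIntegral_congr_fun measurableSet_Ioi hker, integral_finsetSum]
  · rfl
  · exact fun i _ => integrableOn_stieltjesKernel hp hN hX.inv i i

end Trace

section RootSector

theorem inSector_exp {θ : ℝ} (hθ : θ < Real.pi / 2) {w : ℂ} (hw : |w.im| ≤ θ) :
    InSector θ (Complex.exp w) := by
  have h0 : 0 ≤ θ := (abs_nonneg _).trans hw
  have h := abs_le.1 hw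
  have hre : 0 < (Complex.exp w).re := by
    rw [Complex.exp_re]
    exact mul_pos (Real.exp_pos _) (Real.cos_pos_of_mem_Ioo ⟨by linarith, by linarith⟩)
  rw [inSector_iff_abs_arg_le h0 hθ hre, ← Complex.log_im,
    Complex.log_exp (by linarith [Real.pi_pos]) (by linarith [Real.pi_pos])]
  exact hw

theorem inSector_cpow {θ p : ℝ} (hp : 0 ≤ p) (hθ : θ < Real.pi / 2) {μ : ℂ} (hμ : μ ≠ 0)
    (h : p * |μ.arg| ≤ θ) : InSector θ (μ ^ (p : ℂ)) := by
  rw [Complex.cpow_def_of_ne_zero hμ]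
  refine inSector_exp hθ ?_
  rw [Complex.im_mul_ofReal, Complex.log_im, abs_mul, abs_of_nonneg hp, mul_comm]
  exact h

variable {m : Type*} [Fintype m] [DecidableEq m]

theorem abs_arg_le_of_mem_roots_charpoly_mul {θ β : ℝ} (hθ0 : 0 ≤ θ) (hθ : θ < Real.pi / 2) (hβ0 : 0 ≤ β)
    (hβ : β < Real.pi / 2) {X N : Matrix m m ℂ} (hX : Accretive X) (hN : Accretive N)
    (hXs : ∀ v, InSector θ (qform X v)) (hNs : ∀ v, InSector β (qform N v)) {μ : ℂ}
    (hμ : μ ∈ (X * N).charpoly.roots) : μ ≠ 0 ∧ |μ.arg| ≤ β + θ := by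
  have hdet : (μ • (1 : Matrix m m ℂ) - X * N).det = 0 := by
    have := Polynomial.isRoot_of_mem_roots hμ
    rwa [Polynomial.IsRoot, eval_charpoly, scalar_apply, ← smul_one_eq_diagonal] at this
  obtain ⟨v, hv, h⟩ := exists_mulVec_eq_zero_iff.2 hdet
  have h1 : (X * N) *ᵥ v = μ • v := by
    rw [sub_mulVec, smul_mulVec, one_mulVec, sub_eq_zero] at h
    exact h.symm
  have h2 : N *ᵥ v = μ • X⁻¹ *ᵥ v := by
    rw [← mulVec_smul, ← h1, mulVec_mulVec, ← Matrix.mul_assoc, hX.inv_mul_cancel, Matrix.one_mul]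
  have h3 : qform N v = μ * qform X⁻¹ v := by
    rw [qform, h2, dotProduct_smul, smul_eq_mul, qform]
  have ha := hN v hv
  have hb := hX.inv v hv
  have hb0 : qform X⁻¹ v ≠ 0 := fun h => by simp [h] at hb
  have ha0 : qform N v ≠ 0 := fun h => by simp [h] at ha
  have h4 : μ = qform N v * (qform X⁻¹ v)⁻¹ := by rw [h3, mul_inv_cancel_right₀ hb0]
  have hsa := (inSector_iff_abs_arg_le hβ0 hβ ha).1 (hNs v)
  have hsb : |(qform X⁻¹ v)⁻¹.arg| ≤ θ := by
    rw [Complex.abs_arg_inv]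
    refine (inSector_iff_abs_arg_le hθ0 hθ hb).1 ?_
    rw [hX.qform_inv]
    exact inSector_star (hXs _)
  refine ⟨fun h => ha0 (by rw [h3, h, zero_mul]), ?_⟩
  have ha' := abs_le.1 hsa
  have hb' := abs_le.1 hsb
  rw [h4, Complex.arg_mul ha0 (inv_ne_zero hb0) ⟨by linarith, by linarith⟩]
  exact (abs_add_le _ _).trans (add_le_add hsa hsb)

theorem exists_holomorphic_rpow {p : ℝ} (hp : p ∈ Set.Ioc (0 : ℝ) 1) {Y : ℂ → Matrix m m ℂ}
    (hYd : ∀ i j, DifferentiableOn ℂ (fun s => Y s i j) {s | 0 < s.re})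
    (hY : ∀ s : ℂ, 0 < s.re → Accretive (Y s))
    (hYs : ∀ s : ℂ, 0 < s.re → ∀ v, InSector |s.arg| (qform (Y s) v)) :
    ∃ M : ℂ → Matrix m m ℂ, (∀ i j, DifferentiableOn ℂ (fun s => M s i j) {s | 0 < s.re}) ∧
      (∀ s : ℂ, 0 < s.re → Accretive (M s)) ∧
      (∀ s : ℂ, 0 < s.re → ∀ v, InSector (p * |s.arg|) (qform (M s) v)) ∧
      ∀ s : ℂ, (Y s).PosDef → M s = cfc (fun x : ℝ => x ^ p) (Y s) := by
  rcases hp.2.eq_or_lt with rfl | hp1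
  · refine ⟨Y, hYd, hY, by simpa using hYs, fun s hs => ?_⟩
    have h : (fun x : ℝ => x ^ (1 : ℝ)) = id := funext Real.rpow_one
    rw [h, cfc_id ℝ (Y s) hs.isHermitian.isSelfAdjoint]
  have hp' : p ∈ Set.Ioo (0 : ℝ) 1 := ⟨hp.1, hp1⟩
  have hC := rpowConst_pos hp'
  refine ⟨fun s => ((rpowConst p)⁻¹ : ℂ) • stieltjes p (Y s) 1, fun i j => ?_, fun s hs => ?_,
    fun s hs v => ?_, fun s hs => ?_⟩
  · simp only [Matrix.smul_apply, smul_eq_mul]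
    have h1 : Accretive (1 : Matrix m m ℂ) := by
      simpa using accretive_smul_one (m := m) (z := 1) (by simp)
    have h := differentiableOn_stieltjes hp' (D := fun _ => 1) isOpen_re_pos hYd
      (fun _ _ => differentiableOn_const _) hY (fun _ _ => h1) i j
    exact h.const_mul _
  · rw [← Complex.ofReal_inv]
    exact (accretive_stieltjes_one hp' (hY s hs)).smul (inv_pos.2 hC)
  · rw [← Complex.ofReal_inv, qform_smul]
    exact (inSector_stieltjes_one hp' (by
      rw [abs_abs]
      exact Complex.abs_arg_lt_pi_div_two_iff.2 (Or.inl hs)) (hY s hs) (hYs s hs) v).ofReal_mul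
      (inv_pos.2 hC).le
  · simp only
    rw [← cfc_rpow_eq_stieltjes hp' hs, smul_smul]
    change ((rpowConst p : ℂ)⁻¹ * (rpowConst p : ℂ)) • _ = _
    rw [inv_mul_cancel₀ (by exact_mod_cast hC.ne'), one_smul]

end RootSector

section Joukowski

theorem differentiableOn_joukowski {m : Type*} (A B : Matrix m m ℂ) (i j : m) :
    DifferentiableOn ℂ (fun σ : ℂ => (σ • A + σ⁻¹ • B) i j) {s | 0 < s.re} := by
  simp only [Matrix.add_apply, Matrix.smul_apply, smul_eq_mul]
  exact (differentiableOn_id.mul_const _).add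
    ((differentiableOn_id.inv fun s hs h => by simp_all).mul_const _)

variable {m : Type*} [Fintype m]

theorem Matrix.PosDef.qform_eq_ofReal {A : Matrix m m ℂ} (hA : A.PosDef) (v : m → ℂ) :
    ∃ a : ℝ, 0 ≤ a ∧ (v ≠ 0 → 0 < a) ∧ qform A v = a := by
  rcases eq_or_ne v 0 with rfl | hv
  · exact ⟨0, le_rfl, fun h => (h rfl).elim, by simp [qform_zero]⟩
  · obtain ⟨h1, h2⟩ := hA.qform_pos hv
    exact ⟨_, h1.le, fun _ => h1, Complex.ext rfl h2⟩

theorem inSector_qform_joukowski {A B : Matrix m m ℂ} (hA : A.PosDef) (hB : B.PosDef) {σ : ℂ}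
    (hσ : 0 < σ.re) (v : m → ℂ) : InSector |σ.arg| (qform (σ • A + σ⁻¹ • B) v) := by
  obtain ⟨a, ha, -, ha'⟩ := hA.qform_eq_ofReal v
  obtain ⟨b, hb, -, hb'⟩ := hB.qform_eq_ofReal v
  rw [qform_add, qform_smul, qform_smul, ha', hb']
  exact inSector_joukowski hσ ha hb

theorem accretive_joukowski {A B : Matrix m m ℂ} (hA : A.PosDef) (hB : B.PosDef) {σ : ℂ}
    (hσ : 0 < σ.re) : Accretive (σ • A + σ⁻¹ • B) := fun v hv => by
  obtain ⟨a, -, ha, ha'⟩ := hA.qform_eq_ofReal v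
  obtain ⟨b, -, hb, hb'⟩ := hB.qform_eq_ofReal v
  have hσ' : 0 < (σ⁻¹).re := by
    rw [Complex.inv_re]
    exact div_pos hσ (Complex.normSq_pos.2 fun h => by simp [h] at hσ)
  rw [qform_add, qform_smul, qform_smul, ha', hb', Complex.add_re, Complex.re_mul_ofReal,
    Complex.re_mul_ofReal]
  exact add_pos (mul_pos hσ (ha hv)) (mul_pos hσ' (hb hv))

end Joukowski

section FunctionalCalculus

variable {m : Type*} [Fintype m] [DecidableEq m]

theorem Matrix.PosDef.cfc_posDef {Y : Matrix m m ℂ} (hY : Y.PosDef) {f : ℝ → ℝ} (hf : ∀ x, 0 < x → 0 < f x) :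
    (cfc f Y).PosDef := by
  obtain ⟨U, d, hU, hU', hd, hcfc⟩ := exists_cfc_eq_unitary_conj hY
  rw [hcfc f]
  have hD : (diagonal fun i => (f (d i) : ℂ)).PosDef :=
    PosDef.diagonal fun i => by exact_mod_cast hf _ (hd i)
  have := hD.conjTranspose_mul_mul_same (B := star U) fun v w h => by
    simpa [mulVec_mulVec, hU'] using congrArg (U *ᵥ ·) h
  rwa [star_eq_conjTranspose, conjTranspose_conjTranspose] at this

theorem Matrix.PosDef.cfc_sqrt_mul_self {X : Matrix m m ℂ} (hX : X.PosDef) :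
    cfc (fun x : ℝ => x ^ (1 / 2 : ℝ)) X * cfc (fun x : ℝ => x ^ (1 / 2 : ℝ)) X = X := by
  obtain ⟨U, d, hU, hU', hd, hcfc⟩ := exists_cfc_eq_unitary_conj hX
  have hXe : X = U * diagonal (fun i => (d i : ℂ)) * star U := by
    have := hcfc id
    rwa [cfc_id ℝ X hX.isHermitian.isSelfAdjoint] at this
  have hd2 : (fun i => (((d i) ^ (1 / 2 : ℝ) : ℝ) : ℂ) * (((d i) ^ (1 / 2 : ℝ) : ℝ) : ℂ)) =
      fun i => (d i : ℂ) := by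
    funext i
    rw [← Complex.ofReal_mul, ← Real.rpow_add (hd i), add_halves, Real.rpow_one]
  rw [hcfc]
  conv_rhs => rw [hXe, ← hd2, ← diagonal_mul_diagonal]
  simp only [Matrix.mul_assoc]
  rw [← Matrix.mul_assoc (star U) U, hU, Matrix.one_mul]

theorem Matrix.PosDef.cfc_rpow_smul {Y : Matrix m m ℂ} (hY : Y.PosDef) {c : ℝ} (hc : 0 < c) (p : ℝ) :
    cfc (fun x : ℝ => x ^ p) (c • Y) = (c ^ p) • cfc (fun x : ℝ => x ^ p) Y := by
  have hcont : ∀ (f : ℝ → ℝ) (A : Matrix m m ℂ), ContinuousOn f (spectrum ℝ A) := fun f A =>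
    (Matrix.finite_real_spectrum (A := A)).continuousOn f
  have hcont' : ∀ f : ℝ → ℝ, ContinuousOn f ((c • ·) '' spectrum ℝ Y) := fun f =>
    ((Matrix.finite_real_spectrum (A := Y)).image _).continuousOn f
  rw [← cfc_comp_smul c (fun x : ℝ => x ^ p) Y (hcont' _) hY.isHermitian.isSelfAdjoint,
    ← cfc_smul (c ^ p) (fun x : ℝ => x ^ p) Y (hcont _ _)]
  refine cfc_congr fun x hx => ?_
  have hx0 : 0 ≤ x := by
    rw [hY.isHermitian.spectrum_real_eq_range_eigenvalues] at hx
    obtain ⟨i, rfl⟩ := hx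
    exact (hY.eigenvalues_pos i).le
  simp only [smul_eq_mul]
  exact Real.mul_rpow hc.le hx0

theorem Matrix.PosDef.trace_cfc_rpow {W : Matrix m m ℂ} (hW : W.PosDef) (p : ℝ) :
    (cfc (fun x : ℝ => x ^ p) W).trace = (W.charpoly.roots.map fun μ => μ ^ (p : ℂ)).sum := by
  rw [trace_eq_sum_roots_charpoly, hW.isHermitian.charpoly_cfc_eq, hW.isHermitian.roots_charpoly_eq_eigenvalues,
    Polynomial.roots_prod _ _ (Finset.prod_ne_zero_iff.2 fun i _ => Polynomial.X_sub_C_ne_zero _)]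
  simp only [Polynomial.roots_X_sub_C, Multiset.bind_singleton, Multiset.map_map]
  refine congrArg _ (Multiset.map_congr rfl fun i _ => ?_)
  exact Complex.ofReal_cpow (hW.eigenvalues_pos i).le p

end FunctionalCalculus

section PsiS

variable {n k : ℕ} {S : Matrix (Fin n) (Fin k) ℂ}

theorem mulVec_injective_of_conjTranspose_mul_self (hS : Sᴴ * S = 1) : Function.Injective S.mulVec := fun v w h => by
  simpa [mulVec_mulVec, hS] using congrArg (Sᴴ *ᵥ ·) h

theorem posDef_sandwich (hS : Sᴴ * S = 1) {G : Matrix (Fin k) (Fin k) ℂ} {Z : Matrix (Fin n) (Fin n) ℂ}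
    (hG : G.PosDef) (hZ : Z.PosDef) (p : ℝ) :
    (mpow G (1 / 2) * Sᴴ * mpow Z p * S * mpow G (1 / 2)).PosDef := by
  have hR : (mpow G (1 / 2)).PosDef := hG.cfc_posDef fun x hx => Real.rpow_pos_of_pos hx _
  have hM : (mpow Z p).PosDef := hZ.cfc_posDef fun x hx => Real.rpow_pos_of_pos hx _
  have hN := hM.conjTranspose_mul_mul_same (mulVec_injective_of_conjTranspose_mul_self hS)
  have := hN.conjTranspose_mul_mul_same (mulVec_injective_of_isUnit hR.isUnit)
  rw [hR.isHermitian.eq] at this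
  simpa only [Matrix.mul_assoc] using this

theorem PsiS_smul (hS : Sᴴ * S = 1) {α : ℝ} (hα : 0 < α) {G : Matrix (Fin k) (Fin k) ℂ}
    {Z : Matrix (Fin n) (Fin n) ℂ} (hG : G.PosDef) (hZ : Z.PosDef) {c : ℝ} (hc : 0 < c) :
    PsiS α S (c • G) (c • Z) = c * PsiS α S G Z := by
  have hG' : mpow (c • G) (1 / 2) = (c ^ (1 / 2 : ℝ)) • mpow G (1 / 2) := hG.cfc_rpow_smul hc _
  have hZ' : mpow (c • Z) ((1 - α) / α) = (c ^ ((1 - α) / α)) • mpow Z ((1 - α) / α) := hZ.cfc_rpow_smul hc _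
  have hW := posDef_sandwich hS hG hZ ((1 - α) / α)
  have hpow : c ^ (1 / 2 : ℝ) * c ^ ((1 - α) / α) * c ^ (1 / 2 : ℝ) = c ^ (1 / α) := by
    rw [← Real.rpow_add hc, ← Real.rpow_add hc]
    congr 1
    field_simp
    ring
  have hsmul : mpow (c • G) (1 / 2) * Sᴴ * mpow (c • Z) ((1 - α) / α) * S * mpow (c • G) (1 / 2) =
      (c ^ (1 / α)) • (mpow G (1 / 2) * Sᴴ * mpow Z ((1 - α) / α) * S * mpow G (1 / 2)) := by
    rw [hG', hZ', ← hpow]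
    simp only [Matrix.smul_mul, Matrix.mul_smul, smul_smul]
    congr 1
    ring
  have hmpow : mpow ((c ^ (1 / α)) • (mpow G (1 / 2) * Sᴴ * mpow Z ((1 - α) / α) * S * mpow G (1 / 2))) α =
      c • mpow (mpow G (1 / 2) * Sᴴ * mpow Z ((1 - α) / α) * S * mpow G (1 / 2)) α := by
    rw [mpow, hW.cfc_rpow_smul (Real.rpow_pos_of_pos hc _), ← Real.rpow_mul hc.le, one_div_mul_cancel hα.ne',
      Real.rpow_one]
    rfl
  rw [PsiS, hsmul, hmpow, trace_smul, Complex.smul_re, smul_eq_mul, PsiS]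

theorem exists_holomorphic_PsiS_joukowski (hS : Sᴴ * S = 1) {α : ℝ} (hα : α ∈ Set.Ico (1 / 2 : ℝ) 1)
    {A B : Matrix (Fin k) (Fin k) ℂ} {A' B' : Matrix (Fin n) (Fin n) ℂ} (hA : A.PosDef)
    (hB : B.PosDef) (hA' : A'.PosDef) (hB' : B'.PosDef) :
    ∃ h : ℂ → ℂ, DifferentiableOn ℂ h {s | 0 < s.re} ∧
      (∀ s, 0 < s.re → |(h s).im| * s.re ≤ (h s).re * |s.im|) ∧
      ∀ s : ℝ, 0 < s → (h s).re = PsiS α S (s • A + s⁻¹ • B) (s • A' + s⁻¹ • B') := by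
  obtain ⟨hα1, hα2⟩ := hα
  have hα0 : 0 < α := by linarith
  set p := (1 - α) / α with hp
  have hpm : p ∈ Set.Ioc (0 : ℝ) 1 := by
    refine ⟨div_pos (by linarith) hα0, ?_⟩
    rw [hp, div_le_one hα0]
    linarith
  have hpα : α * p = 1 - α := by rw [hp]; field_simp
  obtain ⟨M, hMd, hMa, hMs, hMeq⟩ := exists_holomorphic_rpow hpm (differentiableOn_joukowski A' B')
    (fun s hs => accretive_joukowski hA' hB' hs) (fun s hs => inSector_qform_joukowski hA' hB' hs)
  set X : ℂ → Matrix (Fin k) (Fin k) ℂ := fun s => s • A + s⁻¹ • B with hX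
  set N : ℂ → Matrix (Fin k) (Fin k) ℂ := fun s => Sᴴ * M s * S with hN
  have hXa : ∀ s : ℂ, 0 < s.re → Accretive (X s) := fun s hs => accretive_joukowski hA hB hs
  have hNa : ∀ s : ℂ, 0 < s.re → Accretive (N s) := fun s hs v hv => by
    rw [hN, qform_conj]
    refine hMa s hs _ fun h => hv (mulVec_injective_of_conjTranspose_mul_self hS ?_)
    rw [h, mulVec_zero]
  have hNs : ∀ s : ℂ, 0 < s.re → ∀ v, InSector (p * |s.arg|) (qform (N s) v) := fun s hs v => by
    rw [hN, qform_conj]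
    exact hMs s hs _
  have hNd : ∀ i j, DifferentiableOn ℂ (fun s => N s i j) {s | 0 < s.re} := by
    intro i j
    simp only [hN, Matrix.mul_apply]
    exact DifferentiableOn.fun_sum fun x _ => (DifferentiableOn.fun_sum fun y _ =>
      (hMd y x).const_mul _).mul_const _
  have hXd : ∀ i j, DifferentiableOn ℂ (fun s => (X s)⁻¹ i j) {s | 0 < s.re} := by
    intro i j s hs
    refine (differentiableAt_inv_apply (fun i j => ?_) (hXa s hs).isUnit_det i j).differentiableWithinAt
    exact (differentiableOn_joukowski A B i j).differentiableAt (isOpen_re_pos.mem_nhds hs)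
  have harg : ∀ s : ℂ, 0 < s.re → |s.arg| < Real.pi / 2 := fun s hs =>
    Complex.abs_arg_lt_pi_div_two_iff.2 (Or.inl hs)
  have hroots : ∀ s : ℂ, 0 < s.re → ∀ μ ∈ (X s * N s).charpoly.roots,
      μ ≠ 0 ∧ |μ.arg| ≤ p * |s.arg| + |s.arg| := fun s hs μ hμ => by
    have h1 : p * |s.arg| ≤ |s.arg| := mul_le_of_le_one_left (abs_nonneg _) hpm.2
    exact abs_arg_le_of_mem_roots_charpoly_mul (abs_nonneg _) (harg s hs)
      (mul_nonneg hpm.1.le (abs_nonneg _)) (h1.trans_lt (harg s hs)) (hXa s hs) (hNa s hs)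
      (fun v => inSector_qform_joukowski hA hB hs v) (hNs s hs) hμ
  have hslit : ∀ s : ℂ, 0 < s.re → ∀ μ ∈ (X s * N s).charpoly.roots, μ ∈ Complex.slitPlane :=
      fun s hs μ hμ => by
    obtain ⟨h0, h1⟩ := hroots s hs μ hμ
    refine Complex.mem_slitPlane_iff_arg.2 ⟨fun h => ?_, h0⟩
    rw [h, abs_of_pos Real.pi_pos] at h1
    nlinarith [harg s hs, mul_le_of_le_one_left (abs_nonneg s.arg) hpm.2]
  have hαm : α ∈ Set.Ioo (0 : ℝ) 1 := ⟨hα0, hα2⟩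
  have hC := rpowConst_pos hαm
  have htr : ∀ s : ℂ, 0 < s.re → (rpowConst α : ℂ)⁻¹ * (stieltjes α (N s) (X s)⁻¹).trace =
      ((X s * N s).charpoly.roots.map fun μ => μ ^ (α : ℂ)).sum := fun s hs => by
    rw [trace_stieltjes hαm (hNa s hs) (hXa s hs) (hslit s hs), inv_mul_cancel_left₀]
    exact_mod_cast hC.ne'
  refine ⟨fun s => (rpowConst α : ℂ)⁻¹ * (stieltjes α (N s) (X s)⁻¹).trace, ?_, fun s hs => ?_, fun s hs => ?_⟩
  · simp only [trace, diag_apply]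
    have : ∀ i, DifferentiableOn ℂ (fun s => stieltjes α (N s) (X s)⁻¹ i i) {s | 0 < s.re} := fun i =>
      differentiableOn_stieltjes hαm isOpen_re_pos hNd hXd hNa (fun s hs => (hXa s hs).inv) i i
    exact (DifferentiableOn.fun_sum fun i _ => this i).const_mul _
  · refine InSector.abs_im_mul_re_le hs ?_
    simp only
    rw [htr s hs]
    refine InSector.multiset_sum fun z hz => ?_
    obtain ⟨μ, hμ, rfl⟩ := Multiset.mem_map.1 hz
    obtain ⟨h0, h1⟩ := hroots s hs μ hμ
    refine inSector_cpow hα0.le (harg s hs) h0 ((mul_le_mul_of_nonneg_left h1 hα0.le).trans_eq ?_)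
    rw [mul_add, ← mul_assoc, hpα]
    ring
  · have hre : 0 < (s : ℂ).re := hs
    have hXe : X s = s • A + s⁻¹ • B := by
      simp only [hX]
      rw [← Complex.ofReal_inv]
      simp only [Complex.coe_smul]
    have hYe : (s : ℂ) • A' + (s : ℂ)⁻¹ • B' = s • A' + s⁻¹ • B' := by
      rw [← Complex.ofReal_inv]
      simp only [Complex.coe_smul]
    have hXp : (s • A + s⁻¹ • B).PosDef := (hA.smul hs).add (hB.smul (inv_pos.2 hs))
    have hYp : (s • A' + s⁻¹ • B').PosDef := (hA'.smul hs).add (hB'.smul (inv_pos.2 hs))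
    have hMe : M s = mpow (s • A' + s⁻¹ • B') p := by
      rw [hMeq s (by rw [hYe]; exact hYp), hYe, mpow]
    simp only
    rw [htr s hre, PsiS, mpow, (posDef_sandwich hS hXp hYp _).trace_cfc_rpow,
      charpoly_mul_comm _ (mpow (s • A + s⁻¹ • B) (1 / 2))]
    have hsq : mpow (s • A + s⁻¹ • B) (1 / 2) * mpow (s • A + s⁻¹ • B) (1 / 2) = s • A + s⁻¹ • B :=
      hXp.cfc_sqrt_mul_self
    rw [← hp, ← hMe, hXe]
    simp only [Matrix.mul_assoc]
    rw [← Matrix.mul_assoc (mpow _ (1 / 2)), hsq]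
    simp only [hN, Matrix.mul_assoc]

end PsiS

section Scaling

theorem iteratedDeriv_comp_mul_left_eq (f : ℝ → ℝ) (c : ℝ) (j : ℕ) :
    iteratedDeriv j (fun t => f (c * t)) = fun t => c ^ j * iteratedDeriv j f (c * t) := by
  induction j with
  | zero => simp
  | succ j ih =>
    funext t
    rw [iteratedDeriv_succ, ih, deriv_const_mul_field, deriv_comp_mul_left c (iteratedDeriv j f) t,
      iteratedDeriv_succ, smul_eq_mul, pow_succ, mul_assoc]

theorem third_deriv_le_of_comp_mul_left {f : ℝ → ℝ}
    (h : ∀ c : ℝ, 0 < c → c < 1 → iteratedDeriv 3 (fun t => f (c * t)) 0 ≤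
      -3 * iteratedDeriv 2 (fun t => f (c * t)) 0) :
    iteratedDeriv 3 f 0 ≤ -3 * iteratedDeriv 2 f 0 := by
  have hlim : Filter.Tendsto (fun c : ℝ => c * iteratedDeriv 3 f 0) (nhdsWithin 1 (Set.Iio 1))
      (nhds (1 * iteratedDeriv 3 f 0)) :=
    ((continuous_id.mul continuous_const).tendsto 1).mono_left nhdsWithin_le_nhds
  rw [one_mul] at hlim
  refine le_of_tendsto hlim ?_
  filter_upwards [Ioo_mem_nhdsLT (zero_lt_one' ℝ)] with c hc
  have := h c hc.1 hc.2
  simp only [iteratedDeriv_comp_mul_left_eq, mul_zero] at this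
  have hc2 : 0 < c ^ 2 := pow_pos hc.1 2
  refine le_of_mul_le_mul_left ?_ hc2
  linarith

theorem Matrix.PosDef.add_smul_of_posSemidef {m : Type*} [Fintype m] {G H : Matrix m m ℂ} (hG : G.PosDef)
    (hGH : (G + H).PosSemidef) {c : ℝ} (hc : 0 < c) (hc1 : c < 1) : (G + c • H).PosDef := by
  have h : G + c • H = (1 - c) • G + c • (G + H) := by
    rw [sub_smul, one_smul, smul_add]
    abel
  rw [h]
  exact (hG.smul (sub_pos.2 hc1)).add_posSemidef (hGH.smul hc.le)

end Scaling

theorem PsiS_third_deriv_le {n k : ℕ} {S : Matrix (Fin n) (Fin k) ℂ} (hS : Sᴴ * S = 1)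
    {α : ℝ} (hα : α ∈ Set.Ico (1 / 2 : ℝ) 1)
    {G H : Matrix (Fin k) (Fin k) ℂ} {Z K : Matrix (Fin n) (Fin n) ℂ}
    (hGHp : (G + H).PosDef) (hGHm : (G - H).PosDef)
    (hZKp : (Z + K).PosDef) (hZKm : (Z - K).PosDef) :
    iteratedDeriv 3 (fun t : ℝ => PsiS α S (G + t • H) (Z + t • K)) 0
      ≤ -3 * iteratedDeriv 2 (fun t : ℝ => PsiS α S (G + t • H) (Z + t • K)) 0 := by
  have h2 : (0 : ℝ) < 1 / 2 := by norm_num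
  obtain ⟨h, hd, hsec, hre⟩ := exists_holomorphic_PsiS_joukowski hS hα (hGHp.smul h2) (hGHm.smul h2)
    (hZKp.smul h2) (hZKm.smul h2)
  refine third_deriv_le_of_halfplane hd hsec fun s hs => ?_
  have hc : 0 < 2 * s / (s ^ 2 + 1) := by positivity
  have hline : ∀ {l : ℕ} (P Q : Matrix (Fin l) (Fin l) ℂ), P + ((s ^ 2 - 1) / (s ^ 2 + 1)) • Q =
      (2 * s / (s ^ 2 + 1)) • (s • (1 / 2 : ℝ) • (P + Q) + s⁻¹ • (1 / 2 : ℝ) • (P - Q)) := by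
    intro l P Q
    have e1 : 2 * s / (s ^ 2 + 1) * (s * (1 / 2) + s⁻¹ * (1 / 2)) = 1 := by field_simp
    have e2 : 2 * s / (s ^ 2 + 1) * (s * (1 / 2) - s⁻¹ * (1 / 2)) = (s ^ 2 - 1) / (s ^ 2 + 1) := by field_simp
    rw [← e2]
    nth_rw 1 [← one_smul ℝ P, ← e1]
    module
  have hpd : ∀ {l : ℕ} {P Q : Matrix (Fin l) (Fin l) ℂ}, P.PosDef → Q.PosDef →
      (s • (1 / 2 : ℝ) • P + s⁻¹ • (1 / 2 : ℝ) • Q).PosDef := fun hP hQ =>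
    ((hP.smul h2).smul hs).add ((hQ.smul h2).smul (inv_pos.2 hs))
  rw [hre s hs, ← PsiS_smul hS (h2.trans_le hα.1) (hpd hGHp hGHm) (hpd hZKp hZKm) hc, ← hline, ← hline]

/-- `Ψ_{α,S}` is `(ℝ_≥, 1)`-compatible with `ℍ^k_⪰ × ℍ^n_⪰`: for every positive definite
Hermitian pair `(G, Z)` and every Hermitian direction `(H, K)` with `G ± H` and `Z ± K`
positive semidefinite, the directional derivatives along the line `t ↦ (G + tH, Z + tK)`
satisfy `D³Ψ[(H,K),(H,K),(H,K)] ≤ −3 · D²Ψ[(H,K),(H,K)]`. -/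
theorem stmt9 {n k : ℕ} (S : Matrix (Fin n) (Fin k) ℂ) (hS : Sᴴ * S = 1)
    (α : ℝ) (hα : α ∈ Set.Ico (1 / 2 : ℝ) 1)
    (G H : Matrix (Fin k) (Fin k) ℂ) (Z K : Matrix (Fin n) (Fin n) ℂ)
    (hG : G.PosDef) (hZ : Z.PosDef) (hH : H.IsHermitian) (hK : K.IsHermitian)
    (hGHp : (G + H).PosSemidef) (hGHm : (G - H).PosSemidef)
    (hZKp : (Z + K).PosSemidef) (hZKm : (Z - K).PosSemidef) :
    iteratedDeriv 3 (fun t : ℝ => PsiS α S (G + t • H) (Z + t • K)) 0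
      ≤ -3 * iteratedDeriv 2 (fun t : ℝ => PsiS α S (G + t • H) (Z + t • K)) 0 := by
  refine third_deriv_le_of_comp_mul_left (f := fun t : ℝ => PsiS α S (G + t • H) (Z + t • K))
    fun c hc hc1 => ?_
  simp only [mul_comm c, ← smul_smul]
  refine PsiS_third_deriv_le hS hα (hG.add_smul_of_posSemidef hGHp hc hc1) ?_
    (hZ.add_smul_of_posSemidef hZKp hc hc1) ?_
  · have := hG.add_smul_of_posSemidef (H := -H) (by rwa [← sub_eq_add_neg]) hc hc1
    rwa [smul_neg, ← sub_eq_add_neg] at this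
  · have := hZ.add_smul_of_posSemidef (H := -K) (by rwa [← sub_eq_add_neg]) hc hc1
    rwa [smul_neg, ← sub_eq_add_neg] at this
end

section
/- For every real number d ≥ 1, the number γ := √( (d+3)/(2d+2) + (1/2)·√(1 + 4/(d+1)²) ) is positive and satisfies −γd/2 + √(1 + γ²d²/4) = γ − 1/γ. -/
/-- The central starting point `γ := √((d+3)/(2d+2) + (1/2)·√(1 + 4/(d+1)²))` of the
FastRényiQKD cone (case `s_α = −1`). -/
noncomputable def gammaStart (d : ℝ) : ℝ :=
  Real.sqrt ((d + 3) / (2 * d + 2) + (1 / 2) * Real.sqrt (1 + 4 / (d + 1) ^ 2))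

/-- The square of `gammaStart d` is at least `1`. -/
lemma one_le_gammaStart_sq {d : ℝ} (hd : 0 ≤ d) : 1 ≤ gammaStart d ^ 2 := by
  have hs : 1 ≤ √(1 + 4 / (d + 1) ^ 2) := by
    rw [Real.one_le_sqrt]
    exact le_add_of_nonneg_right (by positivity)
  have hq : 1 / 2 ≤ (d + 3) / (2 * d + 2) := by
    rw [div_le_div_iff₀ (by norm_num) (by positivity)]
    linarith
  rw [gammaStart, Real.sq_sqrt (by positivity)]
  linarith

/-- `gammaStart d ^ 2` is a root of `(d + 1) x² - (d + 3) x + 1`. -/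
lemma gammaStart_sq_quadratic {d : ℝ} (hd : 0 ≤ d) :
    (d + 1) * (gammaStart d ^ 2) ^ 2 - (d + 3) * gammaStart d ^ 2 + 1 = 0 := by
  have hs : √(1 + 4 / (d + 1) ^ 2) ^ 2 = 1 + 4 / (d + 1) ^ 2 := Real.sq_sqrt (by positivity)
  rw [gammaStart, Real.sq_sqrt (by positivity)]
  have hd1 : d + 1 ≠ 0 := by positivity
  have h2 : (d + 3) / (2 * d + 2) = (d + 3) / (d + 1) / 2 := by
    rw [div_div]
    ring_nf
  rw [h2]
  generalize √(1 + 4 / (d + 1) ^ 2) = s at hs ⊢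
  field_simp at hs ⊢
  linear_combination hs

/-- For every real `d ≥ 1`, `γ := √((d+3)/(2d+2) + (1/2)·√(1 + 4/(d+1)²))` is positive
and satisfies `−γd/2 + √(1 + γ²d²/4) = γ − 1/γ`. -/
theorem stmt13 (d : ℝ) (hd : 1 ≤ d) :
    0 < gammaStart d ∧
    -(gammaStart d) * d / 2 + Real.sqrt (1 + (gammaStart d) ^ 2 * d ^ 2 / 4)
      = gammaStart d - 1 / gammaStart d := by
  have hd0 : 0 ≤ d := by linarith
  have h1 := one_le_gammaStart_sq hd0
  have hq := gammaStart_sq_quadratic hd0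
  have hn : 0 ≤ gammaStart d := Real.sqrt_nonneg _
  generalize gammaStart d = g at *
  have hg1 : 1 ≤ g := by nlinarith
  have hg : 0 < g := by linarith
  refine ⟨hg, ?_⟩
  have hinv : 1 / g ≤ 1 := by
    rw [div_le_one hg]
    exact hg1
  have hsqrt : √(1 + g ^ 2 * d ^ 2 / 4) = g - 1 / g + g * d / 2 := by
    rw [Real.sqrt_eq_iff_eq_sq (by positivity) (by nlinarith)]
    field_simp
    linear_combination (-16) * hq
  rw [hsqrt]
  ring
end

section
/- Let f : ℝ → ℝ be continuously differentiable and let F denote the induced spectral function on d×d Hermitian matrices, F(X) := f(X) defined via the continuous functional calculus. Suppose F is Fréchet differentiable at the Hermitian matrix X with derivative DF(X). Then DF(X) is self-adjoint with respect to the Hilbert–Schmidt inner product: for all Hermitian matrices A and H, ⟨A, DF(X)[H]⟩ = ⟨DF(X)[A], H⟩, where ⟨M, N⟩ := Tr[M† N]. -/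
open Matrix

attribute [local instance] Matrix.frobeniusNormedAddCommGroup Matrix.frobeniusNormedSpace

open Filter Topology Polynomial

/-- Hermite interpolation on a finite set with a continuous remainder factor: a differentiable
function is `p + s * k` with `p`, `s` polynomials, `k` continuous, and `s`, `k` vanishing on `S`. -/
lemma exists_eq_eval_add_eval_mul_continuous {f : ℝ → ℝ} (hf : Differentiable ℝ f)
    (S : Finset ℝ) :
    ∃ (p s : ℝ[X]) (k : ℝ → ℝ), Continuous k ∧ (∀ a ∈ S, s.eval a = 0 ∧ k a = 0) ∧
      ∀ x, f x = p.eval x + s.eval x * k x := by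
  classical
  set s : ℝ[X] := Lagrange.nodal S id
  have hinj : Set.InjOn (id : ℝ → ℝ) S := Function.injective_id.injOn
  have hs : ∀ a ∈ S, s.eval a = 0 := fun a ha ↦ Lagrange.eval_nodal_at_node (v := id) ha
  have hs_ne : ∀ x ∉ S, s.eval x ≠ 0 := fun x hx ↦
    Lagrange.eval_nodal_not_at_node (v := id) fun i hi h ↦ hx (h ▸ hi)
  have hs' : ∀ a ∈ S, s.derivative.eval a ≠ 0 := fun a ha ↦ by
    have h := Lagrange.eval_nodal_derivative_eval_node_eq (v := (id : ℝ → ℝ)) ha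
    rw [id] at h
    rw [h]
    exact Lagrange.eval_nodal_not_at_node fun i hi h ↦ Finset.ne_of_mem_erase hi h.symm
  set q := Lagrange.interpolate S id f
  have hq : ∀ a ∈ S, q.eval a = f a := fun a ha ↦ Lagrange.eval_interpolate_at_node f hinj ha
  set c : ℝ → ℝ := fun a ↦ (deriv f a - q.derivative.eval a) / s.derivative.eval a with hc
  set r := Lagrange.interpolate S id c
  have hr : ∀ a ∈ S, r.eval a = c a := fun a ha ↦ Lagrange.eval_interpolate_at_node c hinj ha
  set p := q + s * r with hp
  set k : ℝ → ℝ := fun x ↦ (f x - p.eval x) / s.eval x with hk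
  have hg : ∀ a ∈ S, f a - p.eval a = 0 := fun a ha ↦ by simp [hp, hq a ha, hs a ha]
  refine ⟨p, s, k, continuous_iff_continuousAt.2 fun a ↦ ?_, fun a ha ↦
    ⟨hs a ha, by simp [hk, hs a ha]⟩, fun x ↦ ?_⟩
  · by_cases ha : a ∈ S
    · have hg' : HasDerivAt (fun x ↦ f x - p.eval x) 0 a := by
        have h := (hf a).hasDerivAt.sub (p.hasDerivAt a)
        have h0 : deriv f a - p.derivative.eval a = 0 := by
          have := hs' a ha
          simp only [hp, derivative_add, derivative_mul, eval_add, eval_mul, hs a ha, hr a ha, hc]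
          field_simp
          ring
        rwa [h0] at h
      have hlim := (hasDerivAt_iff_tendsto_slope.1 hg').div
        (hasDerivAt_iff_tendsto_slope.1 (s.hasDerivAt a)) (hs' a ha)
      rw [zero_div] at hlim
      have hka : k a = 0 := by simp [hk, hs a ha]
      refine continuousAt_iff_punctured_nhds.2 ?_
      rw [hka]
      refine hlim.congr' ?_
      filter_upwards [self_mem_nhdsWithin] with x hx
      have hxa : x - a ≠ 0 := sub_ne_zero.2 hx
      simp only [hk, Pi.div_apply, slope_def_field, hg a ha, hs a ha, sub_zero]
      exact div_div_div_cancel_right₀ hxa _ _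
    · exact (hf.continuous.continuousAt.sub p.continuousAt).div s.continuousAt (hs_ne a ha)
  · by_cases hx : x ∈ S
    · simp [hs x hx, sub_eq_zero.1 (hg x hx)]
    · rw [hk, mul_div_cancel₀ _ (hs_ne x hx)]
      ring

lemma continuous_cfc_comp_of_isSelfAdjoint {A : Type*} [CStarAlgebra A] {k : ℝ → ℝ}
    (hk : Continuous k) {a : ℝ → A} (ha : Continuous a) (ha' : ∀ t, IsSelfAdjoint (a t)) :
    Continuous fun t ↦ cfc k (a t) :=
  ha.cfc_of_mem_nhdsSet (s := Set.univ) k (by simp) ha' hk.continuousOn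

namespace Matrix

variable {n : Type*} [Fintype n] [DecidableEq n]

lemma IsHermitian.continuous_cfc_comp {k : ℝ → ℝ} (hk : Continuous k)
    {Y : ℝ → Matrix n n ℂ} (hY : Continuous Y) (hY' : ∀ t, (Y t).IsHermitian) :
    Continuous fun t ↦ cfc k (Y t) :=
  @continuous_cfc_comp_of_isSelfAdjoint _ Matrix.instCStarAlgebra k hk Y hY hY'

/-- The directional derivative of a real polynomial at a Hermitian matrix preserves Hermitian
matrices and is symmetric for the trace form. -/
lemma IsHermitian.exists_hasDerivAt_aeval {X : Matrix n n ℂ} (hX : X.IsHermitian) (p : ℝ[X]) :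
    ∃ L : Matrix n n ℂ → Matrix n n ℂ,
      (∀ H, HasDerivAt (fun t : ℝ ↦ aeval (X + t • H) p) (L H) 0) ∧
      (∀ H, H.IsHermitian → (L H).IsHermitian) ∧
      ∀ A H, (A * L H).trace = (L A * H).trace := by
  induction p using Polynomial.induction_on' with
  | add p q hp hq =>
    obtain ⟨L, hL, hL', hL''⟩ := hp
    obtain ⟨M, hM, hM', hM''⟩ := hq
    refine ⟨fun H ↦ L H + M H, fun H ↦ ?_, fun H hH ↦ (hL' H hH).add (hM' H hH), fun A H ↦ ?_⟩
    · simpa only [map_add] using! (hL H).add (hM H)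
    · simp only [mul_add, add_mul, trace_add, hL'', hM'']
  | monomial m c =>
    refine ⟨fun H ↦ c • ∑ i ∈ Finset.range m, X ^ (m - 1 - i) * H * X ^ i, fun H ↦ ?_,
      fun H hH ↦ ?_, fun A H ↦ ?_⟩
    · let := Matrix.frobeniusNormedRing (m := n) (α := ℂ)
      let := Matrix.frobeniusNormedAlgebra (m := n) (R := ℝ) (α := ℂ)
      have h : HasDerivAt (fun t : ℝ ↦ X + t • H) H 0 := by
        have h := ((hasDerivAt_id (0 : ℝ)).smul_const H).const_add X
        rwa [one_smul] at h
      have h' := (h.fun_pow' m).const_smul c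
      simpa [aeval_monomial, Algebra.smul_def] using! h'
    · have : ∀ i ∈ Finset.range m, (X ^ (m - 1 - i) * H * X ^ i)ᴴ =
          X ^ (m - 1 - (m - 1 - i)) * H * X ^ (m - 1 - i) := fun i hi ↦ by
        have : m - 1 - (m - 1 - i) = i := by have := Finset.mem_range.1 hi; omega
        simp [conjTranspose_mul, conjTranspose_pow, hX.eq, hH.eq, this, mul_assoc]
      rw [IsHermitian, conjTranspose_smul, conjTranspose_sum, Finset.sum_congr rfl this,
        Finset.sum_range_reflect fun j ↦ X ^ (m - 1 - j) * H * X ^ j]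
      simp
    · rw [mul_smul_comm, smul_mul_assoc, trace_smul, trace_smul, Finset.mul_sum, Finset.sum_mul,
        trace_sum, trace_sum, ← Finset.sum_range_reflect]
      congr 1
      refine Finset.sum_congr rfl fun i hi ↦ ?_
      have : m - 1 - (m - 1 - i) = i := by have := Finset.mem_range.1 hi; omega
      rw [this, ← mul_assoc, trace_mul_comm]
      simp only [mul_assoc]

end Matrix

/-- If `F` agrees on Hermitian matrices with the spectral function induced by a `C¹`
function `f : ℝ → ℝ` (via the continuous functional calculus), and `F` is Fréchet
differentiable at the Hermitian matrix `X` with derivative `D = DF(X)`, then `D` is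
self-adjoint with respect to the Hilbert–Schmidt inner product:
`⟨A, D[H]⟩ = ⟨D[A], H⟩`, i.e. `Tr[Aᴴ · D H] = Tr[(D A)ᴴ · H]` for all Hermitian `A, H`. -/
theorem stmt14 {d : ℕ} (f : ℝ → ℝ) (hf : ContDiff ℝ 1 f)
    (F : Matrix (Fin d) (Fin d) ℂ → Matrix (Fin d) (Fin d) ℂ)
    (hF : ∀ Y : Matrix (Fin d) (Fin d) ℂ, Y.IsHermitian → F Y = cfc f Y)
    (X : Matrix (Fin d) (Fin d) ℂ) (hX : X.IsHermitian)
    (D : Matrix (Fin d) (Fin d) ℂ →L[ℝ] Matrix (Fin d) (Fin d) ℂ)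
    (hD : HasFDerivAt F D X) :
    ∀ A H : Matrix (Fin d) (Fin d) ℂ, A.IsHermitian → H.IsHermitian →
      (Aᴴ * D H).trace = ((D A)ᴴ * H).trace := by
  obtain ⟨p, s, k, hk, hsk, hfx⟩ := exists_eq_eval_add_eval_mul_continuous
    (hf.differentiable one_ne_zero) (Finset.univ.image hX.eigenvalues)
  have hspec : ∀ a ∈ spectrum ℝ X, s.eval a = 0 ∧ k a = 0 := fun a ha ↦ by
    rw [hX.spectrum_real_eq_range_eigenvalues] at ha
    exact hsk a (by simpa using ha)
  have hX' : IsSelfAdjoint X := hX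
  have hsX : aeval X s = 0 := by
    rw [← cfc_polynomial s X hX', cfc_congr fun a ha ↦ (hspec a ha).1, cfc_const_zero]
  have hkX : cfc k X = 0 := by
    rw [cfc_congr fun a ha ↦ (hspec a ha).2, cfc_const_zero]
  have hFY : ∀ Y : Matrix (Fin d) (Fin d) ℂ, Y.IsHermitian →
      F Y = aeval Y p + aeval Y s * cfc k Y := fun Y hY ↦ by
    have hY' : IsSelfAdjoint Y := hY
    rw [hF Y hY, ← cfc_polynomial p Y hY', ← cfc_polynomial s Y hY',
      ← cfc_mul _ _ Y s.continuous.continuousOn hk.continuousOn,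
      ← cfc_add Y _ (fun x ↦ s.eval x * k x) p.continuous.continuousOn (s.continuous.mul hk).continuousOn]
    exact cfc_congr fun x _ ↦ hfx x
  obtain ⟨L, hL, hL', hL''⟩ := hX.exists_hasDerivAt_aeval p
  obtain ⟨M, hM, -, -⟩ := hX.exists_hasDerivAt_aeval s
  have hDL : ∀ H : Matrix (Fin d) (Fin d) ℂ, H.IsHermitian → D H = L H := fun H hH ↦ by
    have hY : ∀ t : ℝ, (X + t • H).IsHermitian := fun t ↦ hX.add (hH.smul (IsSelfAdjoint.all t))
    have hcont : Continuous fun t : ℝ ↦ cfc k (X + t • H) :=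
      IsHermitian.continuous_cfc_comp hk (by fun_prop) hY
    have hk0 : Tendsto (fun t : ℝ ↦ cfc k (X + t • H)) (𝓝[≠] 0) (𝓝 0) := by
      have := hcont.tendsto 0
      rw [zero_smul, add_zero, hkX] at this
      exact this.mono_left nhdsWithin_le_nhds
    have hF' := hasDerivAt_iff_tendsto_slope_zero.1 (hD.hasLineDerivAt H)
    have hp' := hasDerivAt_iff_tendsto_slope_zero.1 (hL H)
    have hs' := hasDerivAt_iff_tendsto_slope_zero.1 (hM H)
    have hlim := by
      let := Matrix.frobeniusNormedRing (m := Fin d) (α := ℂ)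
      exact hp'.add (hs'.mul hk0)
    rw [mul_zero, add_zero] at hlim
    refine tendsto_nhds_unique hF' (hlim.congr fun t ↦ ?_)
    simp only [zero_add, zero_smul, add_zero, hsX, sub_zero, hFY _ (hY t), hFY X hX, zero_mul,
      smul_mul_assoc, ← smul_add]
    congr 1
    abel
  intro A H hA hH
  rw [hDL A hA, hDL H hH, hA.eq, (hL' A hA).eq, hL'']
end
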